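/- arXiv:1609.04744 — 2 statements merged into one kernel-verified Lean document; each statement's English description precedes it below -/
import Mathlib

section
/- Let p ∈ (1,∞) with conjugate exponent q = p/(p−1), let μ ∈ P(E), and suppose ∫_E ψ^q dμ < ∞ for some continuous ψ : E → [0,∞). Then for every closed set A ⊂ P_ψ(E) (closed in the ψ-weak topology), limsup_{n→∞} n^{1/p} (μ^n(L_n ∈ A))^{1/q} ≤ (inf_{ν ∈ A} ‖dν/dμ‖_{L^p(μ)} − 1)^{−1}, where ‖dν/dμ‖_{L^p(μ)} := ∞ when ν is not absolutely continuous with respect to μ. -/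
open MeasureTheory ProbabilityTheory Filter Topology Set
open scoped ENNReal NNReal

noncomputable section

namespace SanovDual

attribute [local instance] Classical.propDecidable

/-- The integral of an `EReal`-valued function, with the convention `∞ - ∞ := -∞`. -/
def erealIntegral {X : Type*} [MeasurableSpace X] (μ : Measure X) (f : X → EReal) : EReal :=
  if (∫⁻ x, (if f x = ⊥ then ⊤ else ENNReal.ofReal (-(f x).toReal)) ∂μ) = ⊤ then ⊥
  else ((∫⁻ x, (if f x = ⊤ then ⊤ else ENNReal.ofReal ((f x).toReal)) ∂μ : ℝ≥0∞) : EReal)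
      - ((∫⁻ x, (if f x = ⊥ then ⊤ else ENNReal.ofReal (-(f x).toReal)) ∂μ : ℝ≥0∞) : EReal)

/-- Extension of a function on probability measures to all measures (value `∞` elsewhere). -/
def extend {E : Type*} [MeasurableSpace E] (α : ProbabilityMeasure E → EReal)
    (μ : Measure E) : EReal :=
  if h : IsProbabilityMeasure μ then α ⟨μ, h⟩ else ⊤

/-- The conditional law of the `k`-th coordinate given the first `k` coordinates (`0`-indexed:
given coordinates `0, …, k-1`), under a probability measure on `Fin n → E`. -/
def condLaw {E : Type*} [MeasurableSpace E] [TopologicalSpace E] [PolishSpace E] [BorelSpace E]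
    [Nonempty E] (n : ℕ) (ν : ProbabilityMeasure (Fin n → E)) (k : Fin n) :
    Kernel (Fin (k : ℕ) → E) E :=
  Measure.condKernel ((ν : Measure (Fin n → E)).map
      (fun x => ((fun i : Fin (k : ℕ) => x (Fin.castLE k.isLt.le i)), x k)))

/-- The functional `α_n` on `P(E^n)` built from `α` by summing `α` applied to the successive
conditional laws in the disintegration. -/
def alphan {E : Type*} [MeasurableSpace E] [TopologicalSpace E] [PolishSpace E] [BorelSpace E]
    [Nonempty E] (α : ProbabilityMeasure E → EReal) (n : ℕ)
    (ν : ProbabilityMeasure (Fin n → E)) : EReal :=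
  ∑ k : Fin n, erealIntegral (ν : Measure (Fin n → E))
    (fun x => extend α (condLaw n ν k (fun i => x (Fin.castLE k.isLt.le i))))

/-- The convex conjugate `ρ_n` of `α_n`, acting on (extended-real-valued) functions on `E^n`. -/
def rhon {E : Type*} [MeasurableSpace E] [TopologicalSpace E] [PolishSpace E] [BorelSpace E]
    [Nonempty E] (α : ProbabilityMeasure E → EReal) (n : ℕ) (f : (Fin n → E) → EReal) : EReal :=
  ⨆ ν : ProbabilityMeasure (Fin n → E), erealIntegral (ν : Measure (Fin n → E)) f - alphan α n ν

/-- `ρ = ρ₁` on bounded (real-valued) functions. -/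
def rho {E : Type*} [MeasurableSpace E] (α : ProbabilityMeasure E → EReal) (f : E → ℝ) : EReal :=
  ⨆ ν : ProbabilityMeasure E, ((∫ x, f x ∂(ν : Measure E) : ℝ) : EReal) - α ν

/-- `ρ` on extended-real-valued functions, with the convention `∞ - ∞ := -∞` for integrals. -/
def rhoE {E : Type*} [MeasurableSpace E] (α : ProbabilityMeasure E → EReal) (f : E → EReal) :
    EReal :=
  ⨆ ν : ProbabilityMeasure E, erealIntegral (ν : Measure E) f - α ν

/-- `ρ` on `[0,∞]`-valued functions. -/
def rhoNN {E : Type*} [MeasurableSpace E] (α : ProbabilityMeasure E → EReal) (g : E → ℝ≥0∞) :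
    EReal :=
  ⨆ ν : ProbabilityMeasure E, ((∫⁻ x, g x ∂(ν : Measure E) : ℝ≥0∞) : EReal) - α ν

/-- The empirical measure `L_n(x) = n⁻¹ ∑ δ_{x_i}` as a measure. -/
def empMeasure {E : Type*} [MeasurableSpace E] (n : ℕ) (x : Fin n → E) : Measure E :=
  (n : ℝ≥0∞)⁻¹ • ∑ i : Fin n, Measure.dirac (x i)

/-- The empirical measure `L_n(x)` as a probability measure (junk value for `n = 0`). -/
def empirical {E : Type*} [MeasurableSpace E] [Nonempty E] (n : ℕ) (x : Fin n → E) :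
    ProbabilityMeasure E :=
  if h : IsProbabilityMeasure (empMeasure n x) then ⟨empMeasure n x, h⟩
  else ⟨Measure.dirac (Classical.arbitrary E), inferInstance⟩

/-- `P_ψ(E)`, the probability measures integrating `ψ`. -/
def Pw (E : Type*) [MeasurableSpace E] (ψ : E → ℝ) : Type _ :=
  {ν : ProbabilityMeasure E // ∫⁻ x, ENNReal.ofReal (ψ x) ∂(ν : Measure E) ≠ ⊤}

/-- The underlying probability measure of an element of `P_ψ(E)`. -/
def Pw.toProb {E : Type*} [MeasurableSpace E] {ψ : E → ℝ} (ν : Pw E ψ) :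
    ProbabilityMeasure E :=
  Subtype.val ν

/-- The `ψ`-weak topology on `P_ψ(E)`: the topology generated by the maps `ν ↦ ∫ f dν` over
continuous `f : E → ℝ` with `|f| ≤ 1 + ψ`. -/
instance {E : Type*} [MeasurableSpace E] [TopologicalSpace E] (ψ : E → ℝ) :
    TopologicalSpace (Pw E ψ) :=
  ⨅ (f : E → ℝ) (_ : Continuous f) (_ : ∀ x, |f x| ≤ 1 + ψ x),
    TopologicalSpace.induced (fun ν : Pw E ψ => ∫ x, f x ∂(ν.toProb : Measure E)) inferInstance

/-- Lift a function on `P_ψ(E)` to one on `P(E)` (junk value `⊤` off `P_ψ(E)`). -/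
def liftPw {E : Type*} [MeasurableSpace E] (ψ : E → ℝ) (F : Pw E ψ → EReal)
    (ν : ProbabilityMeasure E) : EReal :=
  if h : ∫⁻ x, ENNReal.ofReal (ψ x) ∂(ν : Measure E) ≠ ⊤ then F ⟨ν, h⟩ else ⊤

/-- The canonical map `EReal → ℝ≥0∞`. -/
def erealToENNReal (x : EReal) : ℝ≥0∞ :=
  if x = ⊤ then ⊤ else ENNReal.ofReal x.toReal

instance {E : Type*} [MeasurableSpace E] : MeasurableSpace (ProbabilityMeasure E) :=
  Subtype.instMeasurableSpace

/-- The `L^p(μ)`-norm of the density `dν/dμ`, with value `∞` if `ν` is not absolutely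
continuous with respect to `μ`. -/
def lpDensityNorm {E : Type*} [MeasurableSpace E] (μ : Measure E) (p : ℝ)
    (ν : ProbabilityMeasure E) : ℝ≥0∞ :=
  if (ν : Measure E) ≪ μ then
    eLpNorm (fun x => ((ν : Measure E).rnDeriv μ x).toReal) (ENNReal.ofReal p) μ
  else ⊤

/-- A one-sided Taylor bound for the exponential with a remainder of order `r ∈ [1, 2]`. -/
theorem exp_le_one_add_add_rpow_mul_exp {r : ℝ} (hr1 : 1 ≤ r) (hr2 : r ≤ 2) (x : ℝ) :
    Real.exp x ≤ 1 + x + |x| ^ r * Real.exp (max x 0) := by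
  have he : 1 ≤ Real.exp (max x 0) := Real.one_le_exp (le_max_right _ _)
  have hpow : 0 ≤ |x| ^ r := Real.rpow_nonneg (abs_nonneg x) r
  rcases le_total |x| 1 with hx | hx
  · have h1 := (abs_le.1 (Real.abs_exp_sub_one_sub_id_le hx)).2
    have h2 : x ^ 2 ≤ |x| ^ r := by
      rcases eq_or_lt_of_le (abs_nonneg x) with h0 | h0
      · have : x = 0 := abs_eq_zero.1 h0.symm
        subst this
        simp [Real.zero_rpow (by linarith : r ≠ 0)]
      · calc x ^ 2 = |x| ^ (2 : ℝ) := by rw [Real.rpow_two, sq_abs]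
          _ ≤ |x| ^ r := Real.rpow_le_rpow_of_exponent_ge h0 hx hr2
    nlinarith
  · have hself : |x| ≤ |x| ^ r := Real.self_le_rpow_of_one_le hx hr1
    rcases le_total 0 x with h0 | h0
    · rw [max_eq_left h0]
      have := Real.exp_pos x
      nlinarith
    · rw [max_eq_right h0, Real.exp_zero, mul_one]
      have := Real.exp_le_one_iff.2 h0
      rw [abs_of_nonpos h0] at hself ⊢
      linarith

/-- The moment generating function of a function with nonpositive mean, truncated from above. -/
theorem integral_exp_min_le {E : Type*} [MeasurableSpace E] {μ : Measure E}
    [IsProbabilityMeasure μ] {Y : E → ℝ} (hY : Measurable Y) (hYi : Integrable Y μ)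
    (hY0 : ∫ x, Y x ∂μ ≤ 0) {r : ℝ} (hr1 : 1 ≤ r) (hr2 : r ≤ 2)
    (hYr : Integrable (fun x => |Y x| ^ r) μ) {t M : ℝ} (ht : 0 ≤ t) (hM : 0 ≤ M) :
    Integrable (fun x => Real.exp (t * min (Y x) M)) μ ∧
    ∫ x, Real.exp (t * min (Y x) M) ∂μ
      ≤ Real.exp ((∫ x, |Y x| ^ r ∂μ) * (t ^ r * Real.exp (t * M))) := by
  have hle : ∀ x, Real.exp (t * min (Y x) M)
      ≤ 1 + t * Y x + |Y x| ^ r * (t ^ r * Real.exp (t * M)) := by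
    intro x
    refine (exp_le_one_add_add_rpow_mul_exp hr1 hr2 _).trans ?_
    have h1 : t * min (Y x) M ≤ t * Y x := mul_le_mul_of_nonneg_left (min_le_left _ _) ht
    have h2 : Real.exp (max (t * min (Y x) M) 0) ≤ Real.exp (t * M) :=
      Real.exp_le_exp.2 (max_le (mul_le_mul_of_nonneg_left (min_le_right _ _) ht)
        (mul_nonneg ht hM))
    have h3 : |min (Y x) M| ≤ |Y x| := by
      rcases le_total (Y x) M with h | h
      · rw [min_eq_left h]
      · rw [min_eq_right h, abs_of_nonneg hM]
        exact h.trans (le_abs_self _)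
    have h4 : |t * min (Y x) M| ^ r ≤ |Y x| ^ r * t ^ r := by
      rw [← Real.mul_rpow (abs_nonneg _) ht, abs_mul, abs_of_nonneg ht, mul_comm]
      exact Real.rpow_le_rpow (by positivity) (mul_le_mul_of_nonneg_right h3 ht) (by linarith)
    have h5 : |t * min (Y x) M| ^ r * Real.exp (max (t * min (Y x) M) 0)
        ≤ |Y x| ^ r * t ^ r * Real.exp (t * M) :=
      mul_le_mul h4 h2 (Real.exp_pos _).le (by positivity)
    linarith
  have hint : Integrable (fun x => Real.exp (t * min (Y x) M)) μ := by
    refine Integrable.mono' (integrable_const (Real.exp (t * M)))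
      (by fun_prop) (Eventually.of_forall fun x => ?_)
    rw [Real.norm_eq_abs, abs_of_pos (Real.exp_pos _)]
    exact Real.exp_le_exp.2 (mul_le_mul_of_nonneg_left (min_le_right _ _) ht)
  refine ⟨hint, ?_⟩
  have hi1 : Integrable (fun x => 1 + t * Y x) μ :=
    (integrable_const (1 : ℝ)).add (hYi.const_mul t)
  have hi2 : Integrable (fun x => |Y x| ^ r * (t ^ r * Real.exp (t * M))) μ := hYr.mul_const _
  calc ∫ x, Real.exp (t * min (Y x) M) ∂μ
      ≤ ∫ x, (1 + t * Y x + |Y x| ^ r * (t ^ r * Real.exp (t * M))) ∂μ :=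
        integral_mono hint (hi1.add hi2) hle
    _ = 1 + t * ∫ x, Y x ∂μ + (∫ x, |Y x| ^ r ∂μ) * (t ^ r * Real.exp (t * M)) := by
        rw [integral_add hi1 hi2, integral_add (integrable_const _) (hYi.const_mul t),
          integral_const_mul, integral_mul_const]
        simp
    _ ≤ (∫ x, |Y x| ^ r ∂μ) * (t ^ r * Real.exp (t * M)) + 1 := by
        nlinarith [mul_nonneg ht (neg_nonneg.2 hY0)]
    _ ≤ _ := Real.add_one_le_exp _

/-- A Fuk–Nagaev type bound for sums of i.i.d. variables with nonpositive mean. -/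
theorem measure_pi_le_sum_le {E : Type*} [MeasurableSpace E] {μ : Measure E}
    [IsProbabilityMeasure μ] {Y : E → ℝ} (hY : Measurable Y) (hYi : Integrable Y μ)
    (hY0 : ∫ x, Y x ∂μ ≤ 0) {r : ℝ} (hr1 : 1 ≤ r) (hr2 : r ≤ 2)
    (hYr : Integrable (fun x => |Y x| ^ r) μ) {t M : ℝ} (ht : 0 ≤ t) (hM : 0 ≤ M)
    (n : ℕ) (a : ℝ) :
    Measure.pi (fun _ : Fin n => μ) {x | a ≤ ∑ i, Y (x i)}
      ≤ n * μ {y | M < Y y} + ENNReal.ofReal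
        (Real.exp (-t * a + n * ((∫ x, |Y x| ^ r ∂μ) * (t ^ r * Real.exp (t * M))))) := by
  set P := Measure.pi (fun _ : Fin n => μ) with hP
  obtain ⟨hint, hmgf⟩ := integral_exp_min_le hY hYi hY0 hr1 hr2 hYr ht hM
  have hsub : {x : Fin n → E | a ≤ ∑ i, Y (x i)} ⊆
      (⋃ i : Fin n, Function.eval i ⁻¹' {y | M < Y y}) ∪
        {x | a ≤ ∑ i, min (Y (x i)) M} := by
    intro x hx
    by_cases h : ∃ i, M < Y (x i)
    · left
      simpa using h
    · right
      push Not at h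
      simpa [min_eq_left (h _)] using hx
  have hunion : P (⋃ i : Fin n, Function.eval i ⁻¹' {y | M < Y y}) ≤ n * μ {y | M < Y y} := by
    refine (measure_iUnion_fintype_le _ _).trans ?_
    have : ∀ i : Fin n, P (Function.eval i ⁻¹' {y | M < Y y}) = μ {y | M < Y y} := fun i =>
      (measurePreserving_eval (fun _ : Fin n => μ) i).measure_preimage
        (measurableSet_lt measurable_const hY).nullMeasurableSet
    simp only [this, Finset.sum_const, Finset.card_univ, Fintype.card_fin, nsmul_eq_mul, le_refl]
  have hexp : ∀ x : Fin n → E, Real.exp (t * ∑ i, min (Y (x i)) M)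
      = ∏ i, Real.exp (t * min (Y (x i)) M) := fun x => by
    rw [Finset.mul_sum, Real.exp_sum]
  have hchernoff : P {x | a ≤ ∑ i, min (Y (x i)) M} ≤ ENNReal.ofReal
      (Real.exp (-t * a + n * ((∫ x, |Y x| ^ r ∂μ) * (t ^ r * Real.exp (t * M))))) := by
    rw [← ofReal_measureReal]
    refine ENNReal.ofReal_le_ofReal ?_
    refine (measure_ge_le_exp_mul_mgf a ht ?_).trans ?_
    · simp_rw [hexp]
      exact Integrable.fintype_prod (f := fun _ y => Real.exp (t * min (Y y) M)) fun _ => hint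
    · rw [Real.exp_add]
      refine mul_le_mul_of_nonneg_left ?_ (Real.exp_pos _).le
      rw [mgf]
      simp_rw [hexp]
      rw [hP, integral_fintype_prod_eq_pow (fun y => Real.exp (t * min (Y y) M)),
        Fintype.card_fin, Real.exp_nat_mul]
      exact pow_le_pow_left₀ (integral_nonneg fun _ => (Real.exp_pos _).le) hmgf n
  exact (measure_mono hsub).trans ((measure_union_le _ _).trans (add_le_add hunion hchernoff))

/-- The tail of an `L^q` function is `o(n^{-q})`. -/
theorem tendsto_rpow_mul_measure_lt {E : Type*} [MeasurableSpace E] {μ : Measure E}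
    [IsFiniteMeasure μ] {Y : E → ℝ} (hY : Measurable Y) {q : ℝ} (hq : 0 < q)
    (hYq : ∫⁻ x, ‖Y x‖ₑ ^ q ∂μ ≠ ⊤) {δ : ℝ} (hδ : 0 < δ) :
    Tendsto (fun n : ℕ => (n : ℝ≥0∞) ^ q * μ {y | δ * n < Y y}) atTop (𝓝 0) := by
  have hmeas : ∀ n : ℕ, MeasurableSet {y | δ * n < Y y} := fun n =>
    measurableSet_lt measurable_const hY
  have htail : Tendsto (fun n : ℕ => μ {y | δ * n < Y y}) atTop (𝓝 0) := by
    have hempty : ⋂ n : ℕ, {y | δ * n < Y y} = ∅ := by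
      refine Set.eq_empty_of_forall_notMem fun y hy => ?_
      obtain ⟨n, hn⟩ := exists_nat_gt (Y y / δ)
      rw [div_lt_iff₀' hδ] at hn
      exact lt_asymm hn (by simpa using Set.mem_iInter.1 hy n)
    have := tendsto_measure_iInter_atTop (μ := μ) (s := fun n : ℕ => {y | δ * n < Y y})
      (fun n => (hmeas n).nullMeasurableSet)
      (fun m n hmn y (hy : δ * n < Y y) =>
        (mul_le_mul_of_nonneg_left (Nat.cast_le.2 hmn) hδ.le).trans_lt hy)
      ⟨0, measure_ne_top _ _⟩
    simpa [hempty, Function.comp_def] using this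
  have hlim := tendsto_setLIntegral_zero hYq (l := atTop)
    (s := fun n : ℕ => {y | δ * n < Y y}) htail
  have hδ0 : ENNReal.ofReal δ ^ q ≠ 0 :=
    (ENNReal.rpow_pos (ENNReal.ofReal_pos.2 hδ) ENNReal.ofReal_ne_top).ne'
  have hδt : ENNReal.ofReal δ ^ q ≠ ⊤ := ENNReal.rpow_ne_top_of_nonneg hq.le ENNReal.ofReal_ne_top
  have hlim' := ENNReal.Tendsto.const_mul (a := (ENNReal.ofReal δ ^ q)⁻¹) hlim
    (Or.inr (ENNReal.inv_ne_top.2 hδ0))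
  rw [mul_zero] at hlim'
  refine tendsto_of_tendsto_of_tendsto_of_le_of_le tendsto_const_nhds hlim'
    (fun _ => zero_le) fun n => ?_
  have hmarkov : ENNReal.ofReal (δ * n) ^ q * μ {y | δ * n < Y y}
      ≤ ∫⁻ y in {y | δ * n < Y y}, ‖Y y‖ₑ ^ q ∂μ := by
    rw [← setLIntegral_const]
    refine setLIntegral_mono' (hmeas n) fun y hy => ?_
    refine ENNReal.rpow_le_rpow ?_ hq.le
    rw [Real.enorm_eq_ofReal_abs]
    exact ENNReal.ofReal_le_ofReal (le_of_lt (lt_of_lt_of_le hy (le_abs_self _)))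
  calc (n : ℝ≥0∞) ^ q * μ {y | δ * n < Y y}
      = (ENNReal.ofReal δ ^ q)⁻¹ * (ENNReal.ofReal (δ * n) ^ q * μ {y | δ * n < Y y}) := by
        rw [ENNReal.ofReal_mul hδ.le, ENNReal.ofReal_natCast, ENNReal.mul_rpow_of_nonneg _ _ hq.le,
          mul_assoc, ← mul_assoc, ENNReal.inv_mul_cancel hδ0 hδt, one_mul]
    _ ≤ _ := mul_le_mul_right hmarkov _

theorem tendsto_rpow_mul_exp_zero {q r ε C θ δ : ℝ} (hr : 1 < r) (hθ : 0 < θ)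
    (hθε : θ * ε = q) (hδ : θ * δ = (r - 1) / 2) :
    Tendsto (fun n : ℕ => (n : ℝ) ^ (q - 1) *
      Real.exp (-(θ * Real.log n / n) * (n * ε) +
        n * (C * ((θ * Real.log n / n) ^ r * Real.exp (θ * Real.log n / n * (δ * n))))))
      atTop (𝓝 0) := by
  have hlog : Tendsto (fun n : ℕ => Real.log n ^ r / (n : ℝ) ^ ((r - 1) / 2)) atTop (𝓝 0) :=
    ((isLittleO_log_rpow_rpow_atTop r (by linarith)).tendsto_div_nhds_zero).comp
      tendsto_natCast_atTop_atTop
  have hexp : Tendsto (fun n : ℕ => Real.exp (C * θ ^ r *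
      (Real.log n ^ r / (n : ℝ) ^ ((r - 1) / 2)))) atTop (𝓝 1) := by
    have := (hlog.const_mul (C * θ ^ r)).rexp
    rwa [mul_zero, Real.exp_zero] at this
  have hinv : Tendsto (fun n : ℕ => ((n : ℝ))⁻¹) atTop (𝓝 0) := tendsto_inv_atTop_nhds_zero_nat
  have := hinv.mul hexp
  rw [zero_mul] at this
  refine this.congr' ?_
  filter_upwards [eventually_ge_atTop 1] with n hn
  have hn1 : (1 : ℝ) ≤ n := by exact_mod_cast hn
  have hn0 : (0 : ℝ) < n := by linarith
  have hl : 0 ≤ Real.log n := Real.log_nonneg hn1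
  have e1 : -(θ * Real.log n / n) * (n * ε) = Real.log n * (-q) := by
    rw [← hθε]; field_simp
  have e2 : θ * Real.log n / n * (δ * n) = Real.log n * ((r - 1) / 2) := by
    rw [← hδ]; field_simp
  have e3 : (n : ℝ) * ((n : ℝ) ^ r)⁻¹ * (n : ℝ) ^ ((r - 1) / 2) = ((n : ℝ) ^ ((r - 1) / 2))⁻¹ := by
    rw [← Real.rpow_neg hn0.le, ← Real.rpow_neg hn0.le]
    nth_rewrite 1 [← Real.rpow_one (n : ℝ)]
    rw [← Real.rpow_add hn0, ← Real.rpow_add hn0]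
    congr 1; ring
  have e4 : (n : ℝ) * (C * ((θ * Real.log n / n) ^ r * (n : ℝ) ^ ((r - 1) / 2)))
      = C * θ ^ r * (Real.log n ^ r / (n : ℝ) ^ ((r - 1) / 2)) := by
    rw [Real.div_rpow (by positivity) hn0.le, Real.mul_rpow hθ.le hl, div_eq_mul_inv _ ((n : ℝ) ^ r),
      div_eq_mul_inv (Real.log n ^ r), ← e3]
    ring
  rw [e1, e2, Real.exp_add, ← Real.rpow_def_of_pos hn0, ← Real.rpow_def_of_pos hn0, e4,
    ← mul_assoc, ← Real.rpow_add hn0]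
  congr 1
  rw [show q - 1 + -q = -1 by ring, Real.rpow_neg_one]

/-- One-sided weak Baum–Katz law: for a centred `L^q` variable, a deviation of the sample mean
has probability `o(n^{1-q})`. -/
theorem tendsto_rpow_mul_measure_pi_sum_ge {E : Type*} [MeasurableSpace E] {μ : Measure E}
    [IsProbabilityMeasure μ] {Y : E → ℝ} (hY : Measurable Y) {q : ℝ} (hq : 1 < q)
    (hYq : MemLp Y (ENNReal.ofReal q) μ) (hY0 : ∫ x, Y x ∂μ ≤ 0) {ε : ℝ} (hε : 0 < ε) :
    Tendsto (fun n : ℕ => (n : ℝ≥0∞) ^ (q - 1) *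
      Measure.pi (fun _ : Fin n => μ) {x | n * ε ≤ ∑ i, Y (x i)}) atTop (𝓝 0) := by
  have hq0 : 0 < q := by linarith
  obtain ⟨r, hr1, hr2, hrq⟩ : ∃ r : ℝ, 1 < r ∧ r ≤ 2 ∧ r ≤ q :=
    ⟨min 2 q, lt_min one_lt_two hq, min_le_left _ _, min_le_right _ _⟩
  have hYr : Integrable (fun x => |Y x| ^ r) μ := by
    have := (hYq.mono_exponent (ENNReal.ofReal_le_ofReal hrq)).integrable_norm_rpow
      (by simpa using by linarith) ENNReal.ofReal_ne_top
    simpa [ENNReal.toReal_ofReal (by linarith : 0 ≤ r)] using this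
  have hYi : Integrable Y μ := hYq.integrable (by simpa using hq.le)
  have hYq' : ∫⁻ x, ‖Y x‖ₑ ^ q ∂μ ≠ ⊤ := by
    have := lintegral_rpow_enorm_lt_top_of_eLpNorm_lt_top (by simpa using hq0)
      ENNReal.ofReal_ne_top hYq.eLpNorm_lt_top
    rw [ENNReal.toReal_ofReal hq0.le] at this
    exact this.ne
  set θ := q / ε with hθ
  have hθ0 : 0 < θ := by positivity
  set δ := (r - 1) / 2 / θ with hδ
  have hδ0 : 0 < δ := div_pos (by linarith) hθ0
  have h1 := tendsto_rpow_mul_measure_lt hY hq0 hYq' hδ0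
  have h2 := ENNReal.tendsto_ofReal (tendsto_rpow_mul_exp_zero (q := q) (ε := ε)
    (C := ∫ x, |Y x| ^ r ∂μ) hr1 hθ0 (by rw [hθ]; field_simp) (δ := δ) (by rw [hδ]; field_simp))
  have h12 := h1.add h2
  rw [ENNReal.ofReal_zero, add_zero] at h12
  refine tendsto_of_tendsto_of_tendsto_of_le_of_le' tendsto_const_nhds h12
    (Eventually.of_forall fun _ => zero_le) ?_
  filter_upwards [eventually_ge_atTop 1] with n hn
  have hn1 : (1 : ℝ) ≤ n := by exact_mod_cast hn
  have hl : 0 ≤ Real.log n := Real.log_nonneg hn1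
  have hb := measure_pi_le_sum_le hY hYi hY0 hr1.le hr2 hYr
    (t := θ * Real.log n / n) (M := δ * n) (by positivity) (by positivity) n (n * ε)
  have hne : (n : ℝ≥0∞) ≠ 0 := by exact_mod_cast (by lia : n ≠ 0)
  calc _ ≤ _ := mul_le_mul_right hb _
    _ = _ := by
      rw [mul_add, ← mul_assoc]
      congr 2
      · nth_rewrite 2 [← ENNReal.rpow_one (n : ℝ≥0∞)]
        rw [← ENNReal.rpow_add _ _ hne (ENNReal.natCast_ne_top n)]
        congr 1; ring
      · rw [ENNReal.ofReal_mul (by positivity), ← ENNReal.ofReal_rpow_of_nonneg (by positivity)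
          (by linarith), ENNReal.ofReal_natCast]

/-- Weak Baum–Katz law: for an `L^q` variable, a deviation of the sample mean from the mean has
probability `o(n^{1-q})`. -/
theorem tendsto_rpow_mul_measure_pi_abs_mean_sub_ge {E : Type*} [MeasurableSpace E]
    {μ : Measure E} [IsProbabilityMeasure μ] {f : E → ℝ} (hf : Measurable f) {q : ℝ} (hq : 1 < q)
    (hfq : MemLp f (ENNReal.ofReal q) μ) {ε : ℝ} (hε : 0 < ε) :
    Tendsto (fun n : ℕ => (n : ℝ≥0∞) ^ (q - 1) *
      Measure.pi (fun _ : Fin n => μ) {x | ε ≤ |(n : ℝ)⁻¹ * ∑ i, f (x i) - ∫ y, f y ∂μ|})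
      atTop (𝓝 0) := by
  set m := ∫ y, f y ∂μ with hm
  have hfi : Integrable f μ := hfq.integrable (by simpa using hq.le)
  have h1 := tendsto_rpow_mul_measure_pi_sum_ge (Y := fun x => f x - m) (by fun_prop) hq
    (hfq.sub (memLp_const m)) (by rw [integral_sub hfi (integrable_const m)]; simp [hm]) hε
  have h2 := tendsto_rpow_mul_measure_pi_sum_ge (Y := fun x => m - f x) (by fun_prop) hq
    ((memLp_const m).sub hfq) (by rw [integral_sub (integrable_const m) hfi]; simp [hm]) hε
  have h12 := h1.add h2
  rw [add_zero] at h12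
  refine tendsto_of_tendsto_of_tendsto_of_le_of_le' tendsto_const_nhds h12
    (Eventually.of_forall fun _ => zero_le) ?_
  filter_upwards [eventually_ge_atTop 1] with n hn
  have hn0 : (0 : ℝ) < n := by exact_mod_cast hn
  rw [← mul_add]
  refine mul_le_mul_right ((measure_mono fun x hx => ?_).trans (measure_union_le _ _)) _
  simp only [mem_ofPred_eq, mem_union, Finset.sum_sub_distrib, Finset.sum_const,
    Finset.card_univ, Fintype.card_fin, nsmul_eq_mul] at hx ⊢
  have hS : n * ((n : ℝ)⁻¹ * ∑ i, f (x i) - m) = ∑ i, f (x i) - n * m := by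
    field_simp
  rcases le_abs.1 hx with h | h
  · left
    nlinarith [mul_le_mul_of_nonneg_left h hn0.le]
  · right
    nlinarith [mul_le_mul_of_nonneg_left h hn0.le]

theorem isProbabilityMeasure_empMeasure {E : Type*} [MeasurableSpace E] {n : ℕ} (hn : n ≠ 0)
    (x : Fin n → E) : IsProbabilityMeasure (empMeasure n x) := by
  constructor
  simp [empMeasure, ENNReal.inv_mul_cancel (by exact_mod_cast hn : (n : ℝ≥0∞) ≠ 0)
    (ENNReal.natCast_ne_top n)]

theorem coe_empirical {E : Type*} [MeasurableSpace E] [Nonempty E] {n : ℕ} (hn : n ≠ 0)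
    (x : Fin n → E) : (empirical n x : Measure E) = empMeasure n x := by
  have h : empirical n x = ⟨empMeasure n x, isProbabilityMeasure_empMeasure hn x⟩ :=
    dif_pos (isProbabilityMeasure_empMeasure hn x)
  rw [h]
  rfl

theorem integral_empirical {E : Type*} [MeasurableSpace E] [MeasurableSingletonClass E]
    [Nonempty E] {n : ℕ} (hn : n ≠ 0) (x : Fin n → E) (f : E → ℝ) :
    ∫ y, f y ∂(empirical n x : Measure E) = (n : ℝ)⁻¹ * ∑ i, f (x i) := by
  rw [coe_empirical hn, empMeasure, integral_smul_measure, integral_finsetSum_measure]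
  · simp
  · exact fun i _ => integrable_dirac (by simp)

/-- The filter of sets of measures which the empirical measure leaves with probability
`o(n^{1-q})`. -/
def empiricalFilter {E : Type*} [MeasurableSpace E] [Nonempty E] (μ : Measure E) (ψ : E → ℝ)
    (q : ℝ) : Filter (Pw E ψ) :=
  Filter.comk
    (fun B => Tendsto (fun n : ℕ => (n : ℝ≥0∞) ^ (q - 1) * Measure.pi (fun _ : Fin n => μ)
      {x | ∃ h, (⟨empirical n x, h⟩ : Pw E ψ) ∈ B}) atTop (𝓝 0))
    (by
      refine tendsto_const_nhds.congr fun n => ?_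
      have hempty : {x : Fin n → E | ∃ h, (⟨empirical n x, h⟩ : Pw E ψ) ∈ (∅ : Set (Pw E ψ))} = ∅ :=
        Set.eq_empty_of_forall_notMem fun _ h => h.choose_spec
      rw [hempty, measure_empty, mul_zero])
    (fun t ht s hst => by
      refine tendsto_of_tendsto_of_tendsto_of_le_of_le tendsto_const_nhds ht
        (fun _ => zero_le) fun n => mul_le_mul_right (measure_mono ?_) _
      rintro x ⟨h, hx⟩
      exact ⟨h, hst hx⟩)
    (fun s hs t ht => by
      have hst := hs.add ht
      rw [add_zero] at hst
      refine tendsto_of_tendsto_of_tendsto_of_le_of_le tendsto_const_nhds hst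
        (fun _ => zero_le) fun n => ?_
      simp only [← mul_add]
      refine mul_le_mul_right ((measure_mono ?_).trans (measure_union_le _ _)) _
      rintro x ⟨h, hx | hx⟩
      · exact Or.inl ⟨h, hx⟩
      · exact Or.inr ⟨h, hx⟩)

theorem empiricalFilter_le_nhds {E : Type*} [MeasurableSpace E] [TopologicalSpace E]
    [PolishSpace E] [BorelSpace E] [Nonempty E] {μ : Measure E} [IsProbabilityMeasure μ]
    {ψ : E → ℝ} {q : ℝ} (hq : 1 < q) (hψq : MemLp ψ (ENNReal.ofReal q) μ)
    (hψ : ∀ x, 0 ≤ ψ x) (ν : Pw E ψ) (hν : (ν.toProb : Measure E) = μ) :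
    empiricalFilter μ ψ q ≤ 𝓝 ν := by
  simp only [nhds_iInf, nhds_induced, le_iInf_iff]
  intro f hf hfψ
  rw [← tendsto_iff_comap, hν]
  refine Metric.tendsto_nhds.2 fun ε hε => Filter.mem_comk.2 ?_
  have hfq : MemLp f (ENNReal.ofReal q) μ :=
    ((memLp_const (1 : ℝ)).add hψq).mono hf.aestronglyMeasurable
      (Eventually.of_forall fun x => by
        simpa [abs_of_nonneg (add_nonneg zero_le_one (hψ x))] using hfψ x)
  refine (tendsto_rpow_mul_measure_pi_abs_mean_sub_ge hf.measurable hq hfq hε).congr' ?_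
  filter_upwards [eventually_ge_atTop 1] with n hn
  have hemp : ∀ x : Fin n → E, ∫⁻ y, ENNReal.ofReal (ψ y) ∂(empirical n x : Measure E) ≠ ⊤ := by
    intro x
    rw [coe_empirical (by lia)]
    simp [empMeasure, ENNReal.mul_eq_top, ENNReal.sum_eq_top, (by lia : n ≠ 0)]
  have hiff : ∀ x : Fin n → E, ε ≤ |(n : ℝ)⁻¹ * ∑ i, f (x i) - ∫ y, f y ∂μ| ↔
      ¬ dist (∫ y, f y ∂(empirical n x : Measure E)) (∫ y, f y ∂μ) < ε := fun x => by
    rw [integral_empirical (by lia), Real.dist_eq, not_lt]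
  congr 2
  ext x
  exact (hiff x).trans ⟨fun h => ⟨hemp x, h⟩, fun ⟨_, h⟩ => h⟩

/-- **Theorem 1.2** (non-exponential Sanov upper bound). -/
theorem lp_sanov
    {E : Type*} [MeasurableSpace E] [TopologicalSpace E] [PolishSpace E] [BorelSpace E]
    [Nonempty E]
    (p q : ℝ) (hp : 1 < p) (hq : q = p / (p - 1))
    (μ : Measure E) [IsProbabilityMeasure μ]
    (ψ : E → ℝ) (hψc : Continuous ψ) (hψ0 : ∀ x, 0 ≤ ψ x)
    (hmom : ∫⁻ x, ENNReal.ofReal (ψ x) ^ q ∂μ ≠ ⊤)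
    (A : Set (Pw E ψ)) (hA : IsClosed A) :
    Filter.limsup (fun n : ℕ =>
        (n : ℝ≥0∞) ^ (1 / p) *
          (Measure.pi (fun _ : Fin n => μ)
              {x : Fin n → E | ∃ h, (⟨empirical n x, h⟩ : Pw E ψ) ∈ A}) ^ (1 / q))
      Filter.atTop
    ≤ ((⨅ (ν : Pw E ψ) (_ : ν ∈ A), lpDensityNorm μ p ν.toProb) - 1)⁻¹ := by
  have hq1 : 1 < q := by
    rw [hq, lt_div_iff₀ (by linarith)]
    linarith
  have hq0 : 0 < q := by linarith
  have hψq : MemLp ψ (ENNReal.ofReal q) μ := by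
    refine ⟨hψc.aestronglyMeasurable, ?_⟩
    rw [eLpNorm_lt_top_iff_lintegral_rpow_enorm_lt_top (by simpa using hq0) ENNReal.ofReal_ne_top,
      ENNReal.toReal_ofReal hq0.le]
    simpa [Real.enorm_eq_ofReal (hψ0 _)] using hmom.lt_top
  have hψi : ∫⁻ x, ENNReal.ofReal (ψ x) ∂μ ≠ ⊤ := by
    have := (hψq.integrable (by simpa using hq1.le)).2.ne
    simpa [Real.enorm_eq_ofReal (hψ0 _)] using this
  set ν : Pw E ψ := ⟨⟨μ, inferInstance⟩, hψi⟩ with hν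
  have hνμ : (ν.toProb : Measure E) = μ := rfl
  by_cases hνA : ν ∈ A
  · have hone : lpDensityNorm μ p ν.toProb = 1 := by
      have hp0 : ENNReal.ofReal p ≠ 0 := by simpa using by linarith
      rw [lpDensityNorm, hνμ, if_pos Measure.AbsolutelyContinuous.rfl, eLpNorm_congr_ae
        (g := fun _ => (1 : ℝ)) ((Measure.rnDeriv_self μ).mono fun x hx => by simp [hx]),
        eLpNorm_const _ hp0 (IsProbabilityMeasure.ne_zero μ)]
      simp
    have hinf : (⨅ (ν : Pw E ψ) (_ : ν ∈ A), lpDensityNorm μ p ν.toProb) ≤ 1 :=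
      (iInf₂_le ν hνA).trans hone.le
    rw [tsub_eq_zero_of_le hinf, ENNReal.inv_zero]
    exact le_top
  · have hmem := empiricalFilter_le_nhds hq1 hψq hψ0 ν hνμ (hA.isOpen_compl.mem_nhds hνA)
    have hlim := Filter.mem_comk.1 hmem
    rw [compl_compl] at hlim
    have hlim' := (ENNReal.continuous_rpow_const (y := 1 / q)).continuousAt.tendsto.comp hlim
    rw [ENNReal.zero_rpow_of_pos (by positivity)] at hlim'
    have hexp : (q - 1) * (1 / q) = 1 / p := by
      rw [hq]
      have : p - 1 ≠ 0 := by linarith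
      field_simp
      ring
    simp only [Function.comp_def, ENNReal.mul_rpow_of_nonneg _ _ (by positivity : 0 ≤ 1 / q),
      ← ENNReal.rpow_mul, hexp] at hlim'
    rw [hlim'.limsup_eq]
    exact zero_le

end SanovDual
end
end

section
/- Let A = { f ∈ B(E) : ∫ f dν ≤ α(ν) for all ν ∈ P(E) } be the acceptance set, and for n ≥ 1 let A_n be the set of tuples (Y₁,…,Yₙ) where each Y_k : E^k → ℝ is measurable and Y_k(x₁,…,x_{k−1},·) ∈ A for every (x₁,…,x_{k−1}) ∈ E^{k−1} and every k = 1,…,n. Then for every f ∈ B(E^n), ρ_n(f) = inf{ y ∈ ℝ : there exists (Y_k)_{k=1}^n ∈ A_n with f(x₁,…,xₙ) ≤ y + Σ_{k=1}^n Y_k(x₁,…,x_k) for all (x₁,…,xₙ) ∈ E^n }, and the infimum is attained. -/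
open MeasureTheory ProbabilityTheory Filter Topology Set
open scoped ENNReal NNReal

noncomputable section

namespace SanovDual

attribute [local instance] Classical.propDecidable

/-- The acceptance set `A = {f ∈ B(E) : ∫ f dν ≤ α(ν) for all ν}`. -/
def acceptSet {E : Type*} [MeasurableSpace E] (α : ProbabilityMeasure E → EReal) :
    Set (E → ℝ) :=
  {g | Measurable g ∧ (∃ C : ℝ, ∀ x, |g x| ≤ C) ∧
    ∀ ν : ProbabilityMeasure E, ((∫ x, g x ∂(ν : Measure E) : ℝ) : EReal) ≤ α ν}

/-- The set of superhedging initial values for `f`, using adapted strategies whose increments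
have all sections in the acceptance set. -/
def hedgeSet {E : Type*} [MeasurableSpace E] (α : ProbabilityMeasure E → EReal) (n : ℕ)
    (f : (Fin n → E) → ℝ) : Set ℝ :=
  {y | ∃ Y : (k : Fin n) → (Fin ((k : ℕ) + 1) → E) → ℝ,
    (∀ k, Measurable (Y k)) ∧
    (∀ (k : Fin n) (z : Fin (k : ℕ) → E), (fun t : E => Y k (Fin.snoc z t)) ∈ acceptSet α) ∧
    ∀ x : Fin n → E, f x ≤ y + ∑ k : Fin n, Y k (fun i => x (Fin.castLE k.isLt i))}

section MeasurabilityOfPenalty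

variable {E : Type*} [MeasurableSpace E] [TopologicalSpace E] [PolishSpace E] [BorelSpace E]

/-- On a second-countable space with outer approximations of closed sets, countably many bounded
continuous functions separate the Borel probability measures. -/
lemma exists_countable_separating_family (E : Type*) [MeasurableSpace E] [TopologicalSpace E]
    [PolishSpace E] [BorelSpace E] :
    ∃ φ : ℕ → BoundedContinuousFunction E ℝ≥0, ∀ μ ν : Measure E, IsProbabilityMeasure μ →
      IsProbabilityMeasure ν → (∀ i, ∫⁻ x, φ i x ∂μ = ∫⁻ x, φ i x ∂ν) → μ = ν := by
  classical
  obtain ⟨b, hbc, -, hb⟩ := TopologicalSpace.exists_countable_basis E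
  let S : Set (Set E) := (fun F : Set (Set E) => ⋂₀ F) '' {F | F.Finite ∧ F ⊆ b}
  have hSc : S.Countable := (Set.countable_ofPred_finite_subset hbc).image _
  have hSne : S.Nonempty := ⟨_, ∅, ⟨Set.finite_empty, Set.empty_subset _⟩, rfl⟩
  have hSopen : ∀ U ∈ S, IsOpen U := by
    rintro U ⟨F, ⟨hF, hFb⟩, rfl⟩
    exact hF.isOpen_sInter fun t ht => hb.isOpen (hFb ht)
  have hSpi : IsPiSystem S := by
    rintro U ⟨F, ⟨hF, hFb⟩, rfl⟩ V ⟨G, ⟨hG, hGb⟩, rfl⟩ -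
    exact ⟨F ∪ G, ⟨hF.union hG, Set.union_subset hFb hGb⟩, Set.sInter_union F G⟩
  have hbS : b ⊆ S := fun U hU =>
    ⟨{U}, ⟨Set.finite_singleton U, Set.singleton_subset_iff.2 hU⟩, Set.sInter_singleton U⟩
  have hgen : (inferInstance : MeasurableSpace E) = MeasurableSpace.generateFrom S := by
    apply le_antisymm
    · rw [‹BorelSpace E›.measurable_eq, hb.borel_eq_generateFrom]
      exact MeasurableSpace.generateFrom_mono hbS
    · exact MeasurableSpace.generateFrom_le fun U hU => (hSopen U hU).measurableSet
  obtain ⟨U, hU⟩ := hSc.exists_eq_range hSne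
  have hUo : ∀ i, IsOpen (U i) := fun i => hSopen _ (hU ▸ Set.mem_range_self i)
  let ψ : ℕ × ℕ → BoundedContinuousFunction E ℝ≥0 := fun p =>
    (hUo p.1).isClosed_compl.apprSeq p.2
  refine ⟨fun i => ψ (Nat.unpair i), fun μ ν hμ hν h => ?_⟩
  refine MeasureTheory.ext_of_generate_finite S hgen hSpi ?_ (by simp)
  intro V hV
  rw [hU] at hV
  obtain ⟨i, rfl⟩ := hV
  have key : μ (U i)ᶜ = ν (U i)ᶜ := by
    refine tendsto_nhds_unique
      (HasOuterApproxClosed.tendsto_lintegral_apprSeq (hUo i).isClosed_compl μ) ?_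
    have := HasOuterApproxClosed.tendsto_lintegral_apprSeq (hUo i).isClosed_compl ν
    refine this.congr fun j => ?_
    have := h (Nat.pair i j)
    simp only [Nat.unpair_pair] at this
    exact this.symm
  rw [← compl_compl (U i), measure_compl (hUo i).measurableSet.compl (measure_ne_top _ _),
    measure_compl (hUo i).measurableSet.compl (measure_ne_top _ _), key]
  simp

lemma measurableSet_kernel_mem_of_isCompact {X : Type*} [MeasurableSpace X] (κ : Kernel X E)
    [IsMarkovKernel κ] {L : Set (ProbabilityMeasure E)} (hL : IsCompact L) :
    MeasurableSet {x | (⟨κ x, inferInstance⟩ : ProbabilityMeasure E) ∈ L} := by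
  obtain ⟨φ, hφ⟩ := exists_countable_separating_family E
  let J : ProbabilityMeasure E → ℕ → ℝ≥0∞ := fun μ i => ∫⁻ x, φ i x ∂(μ : Measure E)
  have hJ : Continuous J := by
    refine continuous_pi fun i => ?_
    exact ProbabilityMeasure.continuous_lintegral_boundedContinuousFunction (φ i)
  have hJinj : Function.Injective J := fun μ ν h =>
    Subtype.ext (hφ μ ν inferInstance inferInstance fun i => congrFun h i)
  have hJL : MeasurableSet (J '' L) := (hL.image hJ).measurableSet
  have hm : Measurable fun x => J ⟨κ x, inferInstance⟩ := by
    refine measurable_pi_lambda _ fun i => ?_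
    exact Measurable.lintegral_kernel
      (measurable_coe_nnreal_ennreal.comp (φ i).continuous.measurable)
  convert hm hJL using 1
  ext x
  exact (hJinj.mem_set_image (s := L)).symm

lemma measurable_extend_kernel {α : ProbabilityMeasure E → EReal} (hbot : ∀ ν, α ν ≠ ⊥)
    (hcompact : ∀ c : ℝ, IsCompact {ν : ProbabilityMeasure E | α ν ≤ (c : EReal)})
    {X : Type*} [MeasurableSpace X] (κ : Kernel X E) [IsMarkovKernel κ] :
    Measurable fun x => extend α (κ x) := by
  have hext : ∀ x, extend α (κ x) = α ⟨κ x, inferInstance⟩ := fun x =>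
    dif_pos (inferInstance : IsProbabilityMeasure (κ x))
  simp only [hext]
  refine measurable_of_Iic fun c => ?_
  induction c with
  | bot =>
    convert MeasurableSet.empty
    ext x
    simpa using hbot _
  | top => simp
  | coe c => exact measurableSet_kernel_mem_of_isCompact κ (hcompact c)

lemma lowerSemicontinuous_of_isCompact_sublevel {α : ProbabilityMeasure E → EReal}
    (hbot : ∀ ν, α ν ≠ ⊥)
    (hcompact : ∀ c : ℝ, IsCompact {ν : ProbabilityMeasure E | α ν ≤ (c : EReal)}) :
    LowerSemicontinuous α := by
  have : T2Space (ProbabilityMeasure E) := inferInstance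
  rw [lowerSemicontinuous_iff_isClosed_preimage]
  intro c
  induction c with
  | bot =>
    convert isClosed_empty
    ext x
    simpa using hbot _
  | top => simp
  | coe c => exact (hcompact c).isClosed

lemma exists_isMinimizer {α : ProbabilityMeasure E → EReal}
    (hproper : ∃ ν, α ν ≠ ⊤) (hbot : ∀ ν, α ν ≠ ⊥)
    (hcompact : ∀ c : ℝ, IsCompact {ν : ProbabilityMeasure E | α ν ≤ (c : EReal)}) :
    ∃ m : ℝ, (∃ ν, α ν = m) ∧ ∀ ν, (m : EReal) ≤ α ν := by
  have hlsc := lowerSemicontinuous_of_isCompact_sublevel hbot hcompact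
  obtain ⟨ν₁, hν₁⟩ := hproper
  have hc : α ν₁ = ((α ν₁).toReal : EReal) := (EReal.coe_toReal hν₁ (hbot _)).symm
  obtain ⟨ν₀, h₀, hmin⟩ := LowerSemicontinuousOn.exists_isMinOn (f := α)
    ⟨ν₁, hc.le⟩ (hcompact (α ν₁).toReal) (hlsc.lowerSemicontinuousOn _)
  have hle : ∀ ν, α ν₀ ≤ α ν := fun ν => by
    by_cases h : α ν ≤ ((α ν₁).toReal : EReal)
    · exact hmin h
    · exact h₀.trans (not_le.1 h).le
  have htop : α ν₀ ≠ ⊤ := fun h => hν₁ (top_le_iff.1 (h ▸ hle ν₁))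
  refine ⟨(α ν₀).toReal, ⟨ν₀, (EReal.coe_toReal htop (hbot _)).symm⟩, fun ν => ?_⟩
  rw [EReal.coe_toReal htop (hbot _)]
  exact hle ν

end MeasurabilityOfPenalty

section ExtendedIntegral

variable {X : Type*} [MeasurableSpace X]

lemma erealIntegral_eq_integral {μ : Measure X} {f : X → ℝ} {g : X → EReal}
    (hf : Integrable f μ) (h : g =ᵐ[μ] fun x => (f x : EReal)) :
    erealIntegral μ g = ((∫ x, f x ∂μ : ℝ) : EReal) := by
  have hN : (∫⁻ x, (if g x = ⊥ then ⊤ else ENNReal.ofReal (-(g x).toReal)) ∂μ)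
      = ∫⁻ x, ENNReal.ofReal (-(f x)) ∂μ :=
    lintegral_congr_ae (h.mono fun x hx => by simp [hx])
  have hP : (∫⁻ x, (if g x = ⊤ then ⊤ else ENNReal.ofReal ((g x).toReal)) ∂μ)
      = ∫⁻ x, ENNReal.ofReal (f x) ∂μ :=
    lintegral_congr_ae (h.mono fun x hx => by simp [hx])
  have hNt : ∫⁻ x, ENNReal.ofReal (-(f x)) ∂μ ≠ ⊤ := hf.neg.lintegral_lt_top.ne
  have hPt : ∫⁻ x, ENNReal.ofReal (f x) ∂μ ≠ ⊤ := hf.lintegral_lt_top.ne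
  rw [erealIntegral, hN, hP, if_neg hNt, integral_eq_lintegral_pos_part_sub_lintegral_neg_part hf,
    EReal.coe_sub, EReal.coe_ennreal_toReal hNt, EReal.coe_ennreal_toReal hPt]

lemma erealIntegral_eq_top_or_integrable {μ : Measure X} [IsFiniteMeasure μ] {g : X → EReal}
    (hg : Measurable g) {m : ℝ} (hm : ∀ x, (m : EReal) ≤ g x) :
    erealIntegral μ g = ⊤ ∨
      (Integrable (fun x => (g x).toReal) μ ∧ g =ᵐ[μ] fun x => ((g x).toReal : EReal)) := by
  have hgb : ∀ x, g x ≠ ⊥ := fun x h => by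
    have := hm x
    rw [h, le_bot_iff] at this
    exact EReal.coe_ne_bot _ this
  have hNle : ∀ x, (if g x = ⊥ then ⊤ else ENNReal.ofReal (-(g x).toReal))
      ≤ ENNReal.ofReal |m| := by
    intro x
    rw [if_neg (hgb x)]
    refine ENNReal.ofReal_le_ofReal ?_
    by_cases ht : g x = ⊤
    · simp [ht]
    · have := hm x
      rw [← EReal.coe_toReal ht (hgb x), EReal.coe_le_coe_iff] at this
      linarith [neg_abs_le m]
  have hN : (∫⁻ x, (if g x = ⊥ then ⊤ else ENNReal.ofReal (-(g x).toReal)) ∂μ) ≠ ⊤ := by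
    refine ne_of_lt (lt_of_le_of_lt (lintegral_mono hNle) ?_)
    rw [lintegral_const]
    exact ENNReal.mul_lt_top ENNReal.ofReal_lt_top (measure_lt_top _ _)
  rcases eq_or_ne (∫⁻ x, (if g x = ⊤ then ⊤ else ENNReal.ofReal ((g x).toReal)) ∂μ) ⊤
    with hP | hP
  · left
    rw [erealIntegral, if_neg hN, hP, EReal.coe_ennreal_top]
    apply EReal.top_sub
    simpa using hN
  · right
    have hmeas : Measurable fun x => (if g x = ⊤ then ⊤ else ENNReal.ofReal ((g x).toReal)) :=
      Measurable.ite (hg (measurableSet_singleton ⊤)) measurable_const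
        (hg.ereal_toReal.ennreal_ofReal)
    have htop : ∀ᵐ x ∂μ, g x ≠ ⊤ := by
      filter_upwards [ae_lt_top hmeas hP] with x hx h
      simp [h] at hx
    refine ⟨⟨hg.ereal_toReal.aestronglyMeasurable, ?_⟩,
      htop.mono fun x hx => (EReal.coe_toReal hx (hgb x)).symm⟩
    rw [hasFiniteIntegral_iff_norm]
    refine lt_of_le_of_lt (lintegral_mono (g := fun x =>
      (if g x = ⊤ then ⊤ else ENNReal.ofReal ((g x).toReal)) + ENNReal.ofReal |m|) ?_) ?_
    · intro x
      by_cases ht : g x = ⊤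
      · simp [ht]
      · simp only [if_neg ht, Real.norm_eq_abs]
        have := hm x
        rw [← EReal.coe_toReal ht (hgb x), EReal.coe_le_coe_iff] at this
        rcases le_total 0 (g x).toReal with h0 | h0
        · rw [abs_of_nonneg h0]
          exact le_self_add
        · refine le_add_left (ENNReal.ofReal_le_ofReal ?_)
          rw [abs_of_nonpos h0]
          linarith [neg_abs_le m]
    · rw [lintegral_add_left hmeas, lintegral_const]
      exact ENNReal.add_lt_top.2 ⟨lt_top_iff_ne_top.2 hP,
        ENNReal.mul_lt_top ENNReal.ofReal_lt_top (measure_lt_top _ _)⟩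

lemma erealIntegral_ne_bot {μ : Measure X} [IsFiniteMeasure μ] {g : X → EReal}
    (hg : Measurable g) {m : ℝ} (hm : ∀ x, (m : EReal) ≤ g x) : erealIntegral μ g ≠ ⊥ := by
  rcases erealIntegral_eq_top_or_integrable (μ := μ) hg hm with h | ⟨h, h'⟩
  · simp [h]
  · rw [erealIntegral_eq_integral h h']
    exact EReal.coe_ne_bot _

lemma erealIntegral_map {Y : Type*} [MeasurableSpace Y] {μ : Measure X} {φ : X → Y}
    (hφ : Measurable φ) {g : Y → EReal} (hg : Measurable g) :
    erealIntegral (μ.map φ) g = erealIntegral μ fun x => g (φ x) := by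
  unfold erealIntegral
  rw [lintegral_map, lintegral_map _ hφ]
  · exact Measurable.ite (hg (measurableSet_singleton ⊤)) measurable_const
      (hg.ereal_toReal.ennreal_ofReal)
  · exact Measurable.ite (hg (measurableSet_singleton ⊥)) measurable_const
      (hg.ereal_toReal.neg.ennreal_ofReal)
  · exact hφ

lemma integrable_of_measurable_of_abs_le {μ : Measure X} [IsFiniteMeasure μ] {f : X → ℝ}
    (hf : Measurable f) {C : ℝ} (hC : ∀ x, |f x| ≤ C) : Integrable f μ :=
  Integrable.of_bound hf.aestronglyMeasurable C (Eventually.of_forall hC)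

end ExtendedIntegral

section Disintegration

variable {E : Type*} [MeasurableSpace E]

lemma measurable_snoc (n : ℕ) :
    Measurable fun p : (Fin n → E) × E => (Fin.snoc p.1 p.2 : Fin (n + 1) → E) := by
  refine measurable_pi_lambda _ fun i => ?_
  induction i using Fin.lastCases with
  | last => simpa using measurable_snd
  | cast i =>
    simp only [Fin.snoc_castSucc]
    exact (measurable_pi_apply i).comp measurable_fst

lemma measurable_init (n : ℕ) : Measurable fun x : Fin (n + 1) → E => (Fin.init x : Fin n → E) :=
  measurable_pi_lambda _ fun i => measurable_pi_apply i.castSucc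

lemma measurable_init_prod_last (n : ℕ) :
    Measurable fun x : Fin (n + 1) → E => ((Fin.init x : Fin n → E), x (Fin.last n)) :=
  (measurable_init n).prodMk (measurable_pi_apply _)

/-- The joint law of the first `n` coordinates. -/
def initLaw {n : ℕ} (ν : ProbabilityMeasure (Fin (n + 1) → E)) : ProbabilityMeasure (Fin n → E) :=
  ν.map (measurable_init n).aemeasurable

lemma initLaw_toMeasure {n : ℕ} (ν : ProbabilityMeasure (Fin (n + 1) → E)) :
    (initLaw ν : Measure (Fin n → E)) = (ν : Measure (Fin (n + 1) → E)).map Fin.init := rfl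

/-- The law of a sequence whose first `n` coordinates have law `μ` and whose last coordinate has
conditional law `κ`. -/
def snocLaw {n : ℕ} (μ : ProbabilityMeasure (Fin n → E)) (κ : Kernel (Fin n → E) E)
    [IsMarkovKernel κ] : ProbabilityMeasure (Fin (n + 1) → E) :=
  ⟨((μ : Measure (Fin n → E)) ⊗ₘ κ).map fun p => Fin.snoc p.1 p.2,
    Measure.isProbabilityMeasure_map (measurable_snoc n).aemeasurable⟩

lemma snocLaw_toMeasure {n : ℕ} (μ : ProbabilityMeasure (Fin n → E)) (κ : Kernel (Fin n → E) E)
    [IsMarkovKernel κ] : (snocLaw μ κ : Measure (Fin (n + 1) → E)) =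
      ((μ : Measure (Fin n → E)) ⊗ₘ κ).map fun p => Fin.snoc p.1 p.2 := rfl

lemma initLaw_snocLaw {n : ℕ} (μ : ProbabilityMeasure (Fin n → E)) (κ : Kernel (Fin n → E) E)
    [IsMarkovKernel κ] : initLaw (snocLaw μ κ) = μ := by
  refine Subtype.ext ?_
  change (initLaw (snocLaw μ κ) : Measure (Fin n → E)) = μ
  rw [initLaw_toMeasure, snocLaw_toMeasure, Measure.map_map (measurable_init n) (measurable_snoc n)]
  have : (Fin.init ∘ fun p : (Fin n → E) × E => (Fin.snoc p.1 p.2 : Fin (n + 1) → E))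
      = Prod.fst := by
    funext p
    exact Fin.init_snoc (α := fun _ => E) p.2 p.1
  rw [this]
  exact Measure.fst_compProd _ _

lemma integrable_comp_snoc {n : ℕ} {μ : ProbabilityMeasure (Fin n → E)}
    {κ : Kernel (Fin n → E) E} [IsMarkovKernel κ] {F : (Fin (n + 1) → E) → ℝ}
    (hF : Integrable F (snocLaw μ κ : Measure (Fin (n + 1) → E))) :
    Integrable (fun p : (Fin n → E) × E => F (Fin.snoc p.1 p.2))
      ((μ : Measure (Fin n → E)) ⊗ₘ κ) := by
  rw [snocLaw_toMeasure] at hF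
  exact (integrable_map_measure hF.1 (measurable_snoc n).aemeasurable).1 hF

lemma integral_snocLaw {n : ℕ} {μ : ProbabilityMeasure (Fin n → E)}
    {κ : Kernel (Fin n → E) E} [IsMarkovKernel κ] {F : (Fin (n + 1) → E) → ℝ}
    (hF : Integrable F (snocLaw μ κ : Measure (Fin (n + 1) → E))) :
    ∫ x, F x ∂(snocLaw μ κ : Measure (Fin (n + 1) → E)) =
      ∫ z, ∫ t, F (Fin.snoc z t) ∂(κ z) ∂(μ : Measure (Fin n → E)) := by
  have h := integrable_comp_snoc hF
  rw [snocLaw_toMeasure] at hF ⊢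
  rw [integral_map (measurable_snoc n).aemeasurable hF.1]
  exact Measure.integral_compProd h

variable [TopologicalSpace E] [PolishSpace E] [BorelSpace E] [Nonempty E]

/-- The conditional law of the last coordinate given the previous ones. -/
def lastLaw {n : ℕ} (ν : ProbabilityMeasure (Fin (n + 1) → E)) : Kernel (Fin n → E) E :=
  condLaw (n + 1) ν (Fin.last n)

lemma lastLaw_eq_condKernel {n : ℕ} (ν : ProbabilityMeasure (Fin (n + 1) → E)) :
    lastLaw ν = Measure.condKernel
      ((ν : Measure (Fin (n + 1) → E)).map fun x => ((Fin.init x : Fin n → E), x (Fin.last n))) :=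
  rfl

instance {n : ℕ} (ν : ProbabilityMeasure (Fin (n + 1) → E)) : IsMarkovKernel (lastLaw ν) := by
  rw [lastLaw_eq_condKernel]
  infer_instance

instance {n : ℕ} (ν : ProbabilityMeasure (Fin n → E)) (k : Fin n) :
    IsMarkovKernel (condLaw n ν k) := by
  have : IsProbabilityMeasure ((ν : Measure (Fin n → E)).map
      (fun x => ((fun i : Fin (k : ℕ) => x (Fin.castLE k.isLt.le i)), x k))) :=
    Measure.isProbabilityMeasure_map ((measurable_pi_lambda _ fun i => measurable_pi_apply _).prodMk
      (measurable_pi_apply _)).aemeasurable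
  unfold condLaw
  infer_instance

lemma snocLaw_initLaw_lastLaw {n : ℕ} (ν : ProbabilityMeasure (Fin (n + 1) → E)) :
    snocLaw (initLaw ν) (lastLaw ν) = ν := by
  refine Subtype.ext ?_
  change (snocLaw (initLaw ν) (lastLaw ν) : Measure (Fin (n + 1) → E)) = ν
  have hfst : (initLaw ν : Measure (Fin n → E)) = ((ν : Measure (Fin (n + 1) → E)).map
      fun x => ((Fin.init x : Fin n → E), x (Fin.last n))).fst := by
    rw [Measure.fst, Measure.map_map measurable_fst (measurable_init_prod_last n)]
    rfl
  rw [snocLaw_toMeasure, hfst, lastLaw_eq_condKernel, Measure.disintegrate,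
    Measure.map_map (measurable_snoc n) (measurable_init_prod_last n)]
  have : ((fun p : (Fin n → E) × E => (Fin.snoc p.1 p.2 : Fin (n + 1) → E)) ∘
      fun x : Fin (n + 1) → E => ((Fin.init x : Fin n → E), x (Fin.last n))) = id := by
    funext x
    exact Fin.snoc_init_self x
  rw [this, Measure.map_id]

lemma lastLaw_snocLaw {n : ℕ} (μ : ProbabilityMeasure (Fin n → E)) (κ : Kernel (Fin n → E) E)
    [IsMarkovKernel κ] : lastLaw (snocLaw μ κ) =ᵐ[(μ : Measure (Fin n → E))] κ := by
  have h : (snocLaw μ κ : Measure (Fin (n + 1) → E)).map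
      (fun x => ((Fin.init x : Fin n → E), x (Fin.last n))) = (μ : Measure (Fin n → E)) ⊗ₘ κ := by
    rw [snocLaw_toMeasure, Measure.map_map (measurable_init_prod_last n) (measurable_snoc n)]
    convert Measure.map_id
    funext p
    exact Prod.ext (Fin.init_snoc (α := fun _ => E) p.2 p.1)
      (Fin.snoc_last (α := fun _ => E) p.2 p.1)
  rw [lastLaw_eq_condKernel]
  simp only [h]
  exact condKernel_compProd _ κ

lemma condLaw_castSucc {n : ℕ} (ν : ProbabilityMeasure (Fin (n + 1) → E)) (k : Fin n) :
    condLaw (n + 1) ν k.castSucc = condLaw n (initLaw ν) k := by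
  have h : (initLaw ν : Measure (Fin n → E)).map
      (fun x => ((fun i : Fin (k : ℕ) => x (Fin.castLE k.isLt.le i)), x k)) =
      (ν : Measure (Fin (n + 1) → E)).map (fun x =>
        ((fun i : Fin (k : ℕ) => x (Fin.castLE k.castSucc.isLt.le i)), x k.castSucc)) := by
    rw [initLaw_toMeasure, Measure.map_map _ (measurable_init n)]
    · rfl
    · exact (measurable_pi_lambda _ fun i => measurable_pi_apply _).prodMk (measurable_pi_apply _)
  unfold condLaw
  simp only [h]
  rfl

variable {α : ProbabilityMeasure E → EReal}

lemma alphan_succ (hbot : ∀ ν, α ν ≠ ⊥)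
    (hcompact : ∀ c : ℝ, IsCompact {ν : ProbabilityMeasure E | α ν ≤ (c : EReal)}) {n : ℕ}
    (ν : ProbabilityMeasure (Fin (n + 1) → E)) :
    alphan α (n + 1) ν = alphan α n (initLaw ν) +
      erealIntegral (initLaw ν : Measure (Fin n → E)) fun z => extend α (lastLaw ν z) := by
  unfold alphan
  rw [Fin.sum_univ_castSucc]
  congr 1
  · refine Finset.sum_congr rfl fun k _ => ?_
    rw [initLaw_toMeasure, erealIntegral_map (measurable_init n), condLaw_castSucc]
    · rfl
    · exact (measurable_extend_kernel hbot hcompact (condLaw n (initLaw ν) k)).comp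
        (measurable_pi_lambda _ fun i => measurable_pi_apply _)
  · rw [initLaw_toMeasure, erealIntegral_map (measurable_init n)]
    · rfl
    · exact measurable_extend_kernel hbot hcompact (lastLaw ν)

lemma alphan_zero (ν : ProbabilityMeasure (Fin 0 → E)) : alphan α 0 ν = 0 := by
  simp [alphan]

end Disintegration

section Hedging

variable {E : Type*} [MeasurableSpace E]

lemma extend_of_isProbabilityMeasure (α : ProbabilityMeasure E → EReal) (μ : Measure E)
    [h : IsProbabilityMeasure μ] : extend α μ = α ⟨μ, h⟩ :=
  dif_pos h

lemma coe_le_extend {α : ProbabilityMeasure E → EReal} {m : ℝ} (hm : ∀ ν, (m : EReal) ≤ α ν)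
    (μ : Measure E) : (m : EReal) ≤ extend α μ := by
  unfold extend
  split_ifs
  · exact hm _
  · exact le_top

variable [TopologicalSpace E] [PolishSpace E] [BorelSpace E] [Nonempty E]
  {α : ProbabilityMeasure E → EReal}

lemma alphan_ne_bot (hbot : ∀ ν, α ν ≠ ⊥)
    (hcompact : ∀ c : ℝ, IsCompact {ν : ProbabilityMeasure E | α ν ≤ (c : EReal)})
    {m : ℝ} (hm : ∀ ν, (m : EReal) ≤ α ν) :
    ∀ (n : ℕ) (ν : ProbabilityMeasure (Fin n → E)), alphan α n ν ≠ ⊥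
  | 0, ν => by simp [alphan_zero]
  | n + 1, ν => by
    rw [alphan_succ hbot hcompact]
    exact EReal.add_ne_bot_iff.2 ⟨alphan_ne_bot hbot hcompact hm n _,
      erealIntegral_ne_bot (measurable_extend_kernel hbot hcompact _) fun z => coe_le_extend hm _⟩

lemma integral_le_of_hedge (hbot : ∀ ν, α ν ≠ ⊥)
    (hcompact : ∀ c : ℝ, IsCompact {ν : ProbabilityMeasure E | α ν ≤ (c : EReal)})
    {m : ℝ} (hm : ∀ ν, (m : EReal) ≤ α ν) (n : ℕ) :
    ∀ (ν : ProbabilityMeasure (Fin n → E)), alphan α n ν ≠ ⊤ →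
    ∀ (F : (Fin n → E) → ℝ), Integrable F (ν : Measure (Fin n → E)) →
    ∀ (y : ℝ) (Y : (k : Fin n) → (Fin ((k : ℕ) + 1) → E) → ℝ),
    (∀ (k : Fin n) (z : Fin (k : ℕ) → E), (fun t : E => Y k (Fin.snoc z t)) ∈ acceptSet α) →
    (∀ᵐ x ∂(ν : Measure (Fin n → E)),
      F x ≤ y + ∑ k : Fin n, Y k (fun i => x (Fin.castLE k.isLt i))) →
    ((∫ x, F x ∂(ν : Measure (Fin n → E)) : ℝ) : EReal) ≤ y + alphan α n ν := by
  induction n with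
  | zero =>
    intro ν _ F hF y Y _ hle
    rw [alphan_zero, add_zero, EReal.coe_le_coe_iff]
    have := integral_mono_ae hF (integrable_const y) (hle.mono fun x hx => by simpa using hx)
    simpa using this
  | succ n ih =>
    intro ν hν F hF y Y hY hle
    rw [alphan_succ hbot hcompact] at hν ⊢
    have hmeas := measurable_extend_kernel hbot hcompact (lastLaw ν)
    have hAb := alphan_ne_bot hbot hcompact hm n (initLaw ν)
    have hBb := erealIntegral_ne_bot (μ := (initLaw ν : Measure (Fin n → E))) hmeas
      fun z => coe_le_extend hm _
    have hA : alphan α n (initLaw ν) ≠ ⊤ := fun h => hν (by rw [h, EReal.top_add_of_ne_bot hBb])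
    have hB : erealIntegral (initLaw ν : Measure (Fin n → E))
        (fun z => extend α (lastLaw ν z)) ≠ ⊤ :=
      fun h => hν (by rw [h, EReal.add_top_of_ne_bot hAb])
    obtain ⟨ha, hae⟩ := (erealIntegral_eq_top_or_integrable
      (μ := (initLaw ν : Measure (Fin n → E))) hmeas
      (fun z => coe_le_extend hm _)).resolve_left hB
    set a : (Fin n → E) → ℝ := fun z => (extend α (lastLaw ν z)).toReal
    have hF' : Integrable F (snocLaw (initLaw ν) (lastLaw ν) : Measure (Fin (n + 1) → E)) := by
      rwa [snocLaw_initLaw_lastLaw]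
    have hFp := integrable_comp_snoc hF'
    have hFint : ∫ x, F x ∂(ν : Measure (Fin (n + 1) → E)) =
        ∫ z, ∫ t, F (Fin.snoc z t) ∂(lastLaw ν z) ∂(initLaw ν : Measure (Fin n → E)) := by
      rw [← integral_snocLaw hF', snocLaw_initLaw_lastLaw]
    have hsec := ((Measure.integrable_compProd_iff hFp.1).1 hFp).1
    have hFi : Integrable (fun z => ∫ t, F (Fin.snoc z t) ∂(lastLaw ν z))
        (initLaw ν : Measure (Fin n → E)) :=
      Integrable.integral_compProd (κ := Kernel.const Unit (initLaw ν : Measure (Fin n → E)))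
        (η := Kernel.prodMkLeft Unit (lastLaw ν)) (a := ()) hFp
    have hle' : ∀ᵐ z ∂(initLaw ν : Measure (Fin n → E)), ∀ᵐ t ∂(lastLaw ν z),
        F (Fin.snoc z t) ≤ y + ∑ k : Fin (n + 1), Y k
          (fun i => (Fin.snoc z t : Fin (n + 1) → E) (Fin.castLE k.isLt i)) := by
      refine Measure.ae_ae_of_ae_compProd (p := fun p : (Fin n → E) × E =>
        F (Fin.snoc p.1 p.2) ≤ y + ∑ k : Fin (n + 1), Y k
          (fun i => (Fin.snoc p.1 p.2 : Fin (n + 1) → E) (Fin.castLE k.isLt i))) ?_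
      refine ae_of_ae_map (p := fun x => F x ≤ y + ∑ k : Fin (n + 1), Y k
        (fun i => x (Fin.castLE k.isLt i))) (measurable_snoc n).aemeasurable ?_
      rw [← snocLaw_toMeasure, snocLaw_initLaw_lastLaw]
      exact hle
    have key := ih (initLaw ν) hA (fun z => ∫ t, F (Fin.snoc z t) ∂(lastLaw ν z) - a z)
      (hFi.sub ha) y (fun k => Y k.castSucc) (fun k z => hY k.castSucc z) (by
        filter_upwards [hsec, hle', hae] with z hz hz' haz
        obtain ⟨hYm, ⟨C, hC⟩, hYle⟩ := hY (Fin.last n) z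
        have h1 : ∫ t, F (Fin.snoc z t) ∂(lastLaw ν z) ≤
            ∫ t, ((y + ∑ k : Fin n, Y k.castSucc (fun i => z (Fin.castLE k.isLt i)))
              + Y (Fin.last n) (Fin.snoc z t)) ∂(lastLaw ν z) := by
          refine integral_mono_ae hz
            ((integrable_const _).add (integrable_of_measurable_of_abs_le hYm hC)) ?_
          filter_upwards [hz'] with t ht
          rw [Fin.sum_univ_castSucc, ← add_assoc] at ht
          have hk : ∀ k : Fin n, (fun i => (Fin.snoc z t : Fin (n + 1) → E)
              (Fin.castLE k.castSucc.isLt i)) = fun i => z (Fin.castLE k.isLt i) := fun k =>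
            funext fun i => Fin.snoc_castSucc (α := fun _ => E) t z (Fin.castLE k.isLt i)
          have hs : ∑ k : Fin n, Y k.castSucc (fun i => (Fin.snoc z t : Fin (n + 1) → E)
              (Fin.castLE k.castSucc.isLt i)) =
              ∑ k : Fin n, Y k.castSucc (fun i => z (Fin.castLE k.isLt i)) :=
            Finset.sum_congr rfl fun k _ => congrArg (Y k.castSucc) (hk k)
          rw [hs] at ht
          exact ht
        rw [integral_add (integrable_const _) (integrable_of_measurable_of_abs_le hYm hC)] at h1
        have h2 := hYle ⟨lastLaw ν z, inferInstance⟩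
        rw [← extend_of_isProbabilityMeasure α (lastLaw ν z), haz] at h2
        have h3 := EReal.coe_le_coe_iff.1 h2
        simp only [integral_const, probReal_univ, one_smul, ProbabilityMeasure.coe_mk] at h1 h3
        exact sub_le_iff_le_add.2 (h1.trans (add_le_add le_rfl h3)))
    rw [integral_sub hFi ha, ← hFint] at key
    rw [erealIntegral_eq_integral ha hae]
    rw [← EReal.coe_toReal hA hAb] at key ⊢
    norm_cast at key ⊢
    linarith

lemma rhon_le_of_mem_hedgeSet (hbot : ∀ ν, α ν ≠ ⊥)
    (hcompact : ∀ c : ℝ, IsCompact {ν : ProbabilityMeasure E | α ν ≤ (c : EReal)})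
    {m : ℝ} (hm : ∀ ν, (m : EReal) ≤ α ν) {n : ℕ} {f : (Fin n → E) → ℝ} (hf : Measurable f)
    {C : ℝ} (hC : ∀ x, |f x| ≤ C) {y : ℝ} (hy : y ∈ hedgeSet α n f) :
    rhon α n (fun x => (f x : EReal)) ≤ y := by
  obtain ⟨Y, -, hY, hle⟩ := hy
  refine iSup_le fun ν => ?_
  have hfi : Integrable f (ν : Measure (Fin n → E)) := integrable_of_measurable_of_abs_le hf hC
  rw [erealIntegral_eq_integral hfi (Eventually.of_forall fun _ => rfl)]
  by_cases hν : alphan α n ν = ⊤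
  · simp [hν]
  · have hb := alphan_ne_bot hbot hcompact hm n ν
    exact EReal.sub_le_of_le_add (integral_le_of_hedge hbot hcompact hm n ν hν f hfi y Y hY
      (Eventually.of_forall hle))

end Hedging

section Chain

lemma sum_sub_init {F : Type*} (h : (k : ℕ) → (Fin k → F) → ℝ) :
    ∀ (n : ℕ) (x : Fin n → F),
      ∑ k : Fin n, (h (k + 1) (fun i => x (Fin.castLE k.isLt i)) -
        h k (Fin.init fun i : Fin ((k : ℕ) + 1) => x (Fin.castLE k.isLt i))) =
      h n x - h 0 Fin.elim0
  | 0, x => by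
    rw [Subsingleton.elim x Fin.elim0]
    simp
  | n + 1, x => by
    rw [Fin.sum_univ_castSucc]
    have := sum_sub_init h n (Fin.init x)
    have h1 : h (n + 1) x - h n (Fin.init x) + (h n (Fin.init x) - h 0 Fin.elim0) =
        h (n + 1) x - h 0 Fin.elim0 := by ring
    rw [← h1, ← this, add_comm]
    rfl

variable {E : Type*} [MeasurableSpace E]

/-- A bounded family of functions of finite sequences that dominates `g` at time `n`, decreases
under the one-step operators going backwards, and starts below `y`. -/
def HasChain (α : ProbabilityMeasure E → EReal) (B : ℝ) (n : ℕ) (g : (Fin n → E) → ℝ)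
    (y : ℝ) : Prop :=
  ∃ h : (k : ℕ) → (Fin k → E) → ℝ, (∀ k, Measurable (h k)) ∧ (∀ k z, |h k z| ≤ B) ∧
    (∀ k < n, ∀ (z : Fin k → E) (ν : ProbabilityMeasure E), α ν ≠ ⊤ →
      ∫ t, h (k + 1) (Fin.snoc z t) ∂(ν : Measure E) - (α ν).toReal ≤ h k z) ∧
    (∀ x, g x ≤ h n x) ∧ ∀ z, h 0 z ≤ y

lemma HasChain.mono {α : ProbabilityMeasure E → EReal} {B : ℝ} {n : ℕ}
    {g g' : (Fin n → E) → ℝ} {y y' : ℝ} (h : HasChain α B n g y) (hg : ∀ x, g' x ≤ g x)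
    (hy : y ≤ y') : HasChain α B n g' y' := by
  obtain ⟨h, h1, h2, h3, h4, h5⟩ := h
  exact ⟨h, h1, h2, h3, fun x => (hg x).trans (h4 x), fun z => (h5 z).trans hy⟩

lemma HasChain.mem_hedgeSet {α : ProbabilityMeasure E → EReal} (hbot : ∀ ν, α ν ≠ ⊥) {B : ℝ}
    {n : ℕ} {g : (Fin n → E) → ℝ} {y : ℝ} (h : HasChain α B n g y) : y ∈ hedgeSet α n g := by
  obtain ⟨h, h1, h2, h3, h4, h5⟩ := h
  refine ⟨fun k x => h (k + 1) x - h k (Fin.init x),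
    fun k => (h1 _).sub ((h1 _).comp (measurable_init _)), fun k z => ?_, fun x => ?_⟩
  · have hm : Measurable fun t : E => h (k + 1) (Fin.snoc z t) :=
      (h1 _).comp ((measurable_snoc k).comp measurable_prodMk_left)
    simp only [Fin.init_snoc]
    refine ⟨hm.sub_const _, ⟨B + B, fun t => ?_⟩, fun ν => ?_⟩
    · exact (abs_sub _ _).trans (add_le_add (h2 _ _) (h2 _ _))
    · by_cases hν : α ν = ⊤
      · simp [hν]
      rw [integral_sub (integrable_of_measurable_of_abs_le hm fun t => h2 _ _)
        (integrable_const _), integral_const, probReal_univ, one_smul,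
        ← EReal.coe_toReal hν (hbot ν), EReal.coe_le_coe_iff]
      linarith [h3 k k.isLt z ν hν]
  · rw [sum_sub_init h n x]
    linarith [h4 x, h5 Fin.elim0]

lemma HasChain.of_eventually_le {α : ProbabilityMeasure E → EReal} {B : ℝ} {n : ℕ}
    {g : (Fin n → E) → ℝ} {y : ℝ} {gs : ℕ → (Fin n → E) → ℝ} {ys : ℕ → ℝ}
    (h : ∀ i, HasChain α B n (gs i) (ys i)) (hg : ∀ x, ∀ᶠ i in atTop, g x ≤ gs i x)
    (hy : Tendsto ys atTop (𝓝 y)) : HasChain α B n g y := by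
  choose h h1 h2 h3 h4 h5 using h
  let l : (k : ℕ) → ℕ → (Fin k → E) → ℝ := fun k j z => ⨅ i, h (i + j) k z
  have hbb : ∀ k j z, BddBelow (range fun i => h (i + j) k z) := fun k j z =>
    ⟨-B, by rintro _ ⟨i, rfl⟩; exact (abs_le.1 (h2 _ _ _)).1⟩
  have hl_le : ∀ k j z i, l k j z ≤ h (i + j) k z := fun k j z i => ciInf_le (hbb k j z) i
  have hl_abs : ∀ k j z, |l k j z| ≤ B := fun k j z => abs_le.2
    ⟨le_ciInf fun i => (abs_le.1 (h2 _ _ _)).1, (hl_le k j z 0).trans (abs_le.1 (h2 _ _ _)).2⟩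
  have hl_meas : ∀ k j, Measurable (l k j) := fun k j => Measurable.iInf fun i => h1 _ _
  have hl_mono : ∀ k z, Monotone fun j => l k j z := fun k z =>
    monotone_nat_of_le_succ fun j => le_ciInf fun i => by
      have := hl_le k j z (i + 1)
      rwa [add_right_comm, add_assoc] at this
  have hba : ∀ k z, BddAbove (range fun j => l k j z) := fun k z =>
    ⟨B, by rintro _ ⟨i, rfl⟩; exact (abs_le.1 (hl_abs _ _ _)).2⟩
  have hl_lim : ∀ k z, Tendsto (fun j => l k j z) atTop (𝓝 (⨆ j, l k j z)) := fun k z =>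
    tendsto_atTop_ciSup (hl_mono k z) (hba k z)
  refine ⟨fun k z => ⨆ j, l k j z, fun k => Measurable.iSup (hl_meas k), fun k z => ?_,
    fun k hk z ν hν => ?_, fun x => ?_, fun z => ?_⟩
  · exact abs_le.2 ⟨(abs_le.1 (hl_abs k 0 z)).1.trans (le_ciSup (hba k z) 0),
      ciSup_le fun j => (abs_le.1 (hl_abs _ _ _)).2⟩
  · have hs : ∀ {u : (Fin (k + 1) → E) → ℝ}, Measurable u →
        Measurable fun t => u (Fin.snoc z t) := fun hu =>
      hu.comp ((measurable_snoc k).comp measurable_prodMk_left)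
    have ht : Tendsto (fun j => ∫ t, l (k + 1) j (Fin.snoc z t) ∂(ν : Measure E)) atTop
        (𝓝 (∫ t, ⨆ j, l (k + 1) j (Fin.snoc z t) ∂(ν : Measure E))) :=
      tendsto_integral_of_dominated_convergence (fun _ => B)
        (fun j => (hs (hl_meas _ j)).aestronglyMeasurable) (integrable_const _)
        (fun j => Eventually.of_forall fun t => hl_abs _ _ _)
        (Eventually.of_forall fun t => hl_lim _ _)
    refine le_of_tendsto (ht.sub_const _) (Eventually.of_forall fun j => ?_)
    refine le_trans (le_ciInf fun i => le_trans ?_ (h3 (i + j) k hk z ν hν)) (le_ciSup (hba k z) j)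
    exact sub_le_sub_right (integral_mono
      (integrable_of_measurable_of_abs_le (hs (hl_meas _ j)) fun t => hl_abs _ _ _)
      (integrable_of_measurable_of_abs_le (hs (h1 _ _)) fun t => h2 _ _ _)
      fun t => hl_le _ _ _ _) _
  · obtain ⟨N, hN⟩ := eventually_atTop.1 (hg x)
    exact le_trans (le_ciInf fun i => (hN _ (Nat.le_add_left N i)).trans (h4 _ x))
      (le_ciSup (hba n x) N)
  · exact ciSup_le fun j => ge_of_tendsto (hy.comp (tendsto_add_atTop_nat j))
      (Eventually.of_forall fun i => (hl_le 0 j z i).trans (h5 _ z))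

end Chain

section StepValue

variable {E : Type*} [MeasurableSpace E]

/-- The one-step operator: optimize over the conditional law of the last coordinate. -/
def stepValue (α : ProbabilityMeasure E → EReal) {n : ℕ} (g : (Fin (n + 1) → E) → ℝ)
    (z : Fin n → E) : ℝ :=
  ⨆ ν : {ν : ProbabilityMeasure E // α ν ≠ ⊤},
    (∫ t, g (Fin.snoc z t) ∂(ν.1 : Measure E) - (α ν.1).toReal)

/-- The iterated one-step operator. -/
def value (α : ProbabilityMeasure E → EReal) : (n : ℕ) → ((Fin n → E) → ℝ) → ℝ
  | 0, g => g Fin.elim0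
  | n + 1, g => value α n (stepValue α g)

lemma abs_integral_le {X : Type*} [MeasurableSpace X] (μ : Measure X) [IsProbabilityMeasure μ]
    {f : X → ℝ} {C : ℝ} (hC : ∀ x, |f x| ≤ C) : |∫ x, f x ∂μ| ≤ C := by
  simpa using norm_integral_le_of_norm_le_const (μ := μ) (f := f) (Eventually.of_forall hC)

variable {α : ProbabilityMeasure E → EReal} {m : ℝ} {n : ℕ}

lemma le_toReal_of_coe_le (hm : ∀ ν, (m : EReal) ≤ α ν) {ν : ProbabilityMeasure E}
    (hν : α ν ≠ ⊤) : m ≤ (α ν).toReal := by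
  have h := EReal.toReal_le_toReal (hm ν) (EReal.coe_ne_bot m) hν
  rwa [EReal.toReal_coe] at h

lemma bddAbove_range_stepValue (hm : ∀ ν, (m : EReal) ≤ α ν) {g : (Fin (n + 1) → E) → ℝ}
    {C : ℝ} (hC : ∀ x, |g x| ≤ C) (z : Fin n → E) :
    BddAbove (range fun ν : {ν : ProbabilityMeasure E // α ν ≠ ⊤} =>
      ∫ t, g (Fin.snoc z t) ∂(ν.1 : Measure E) - (α ν.1).toReal) := by
  refine ⟨C - m, ?_⟩
  rintro _ ⟨ν, rfl⟩
  exact sub_le_sub (abs_le.1 (abs_integral_le _ fun t => hC _)).2 (le_toReal_of_coe_le hm ν.2)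

lemma le_stepValue (hm : ∀ ν, (m : EReal) ≤ α ν) {g : (Fin (n + 1) → E) → ℝ}
    {C : ℝ} (hC : ∀ x, |g x| ≤ C) (z : Fin n → E) {ν : ProbabilityMeasure E} (hν : α ν ≠ ⊤) :
    ∫ t, g (Fin.snoc z t) ∂(ν : Measure E) - (α ν).toReal ≤ stepValue α g z :=
  le_ciSup (bddAbove_range_stepValue hm hC z) ⟨ν, hν⟩

lemma abs_stepValue_le (hm₀ : ∃ ν, α ν = m) (hm : ∀ ν, (m : EReal) ≤ α ν)
    {g : (Fin (n + 1) → E) → ℝ} {C : ℝ} (hC : ∀ x, |g x| ≤ C) (z : Fin n → E) :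
    |stepValue α g z| ≤ C + |m| := by
  obtain ⟨ν₀, h₀⟩ := hm₀
  have h₀' : α ν₀ ≠ ⊤ := by simp [h₀]
  have : Nonempty {ν : ProbabilityMeasure E // α ν ≠ ⊤} := ⟨⟨ν₀, h₀'⟩⟩
  refine abs_le.2 ⟨?_, ciSup_le fun ν => ?_⟩
  · have h1 := le_stepValue hm hC z h₀'
    have h2 := (abs_le.1 (abs_integral_le (ν₀ : Measure E)
      (f := fun t => g (Fin.snoc z t)) fun t => hC _)).1
    rw [h₀, EReal.toReal_coe] at h1
    linarith [le_abs_self m]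
  · have h1 := (abs_le.1 (abs_integral_le (ν.1 : Measure E)
      (f := fun t => g (Fin.snoc z t)) fun t => hC _)).2
    linarith [le_toReal_of_coe_le hm ν.2, neg_abs_le m]

lemma stepValue_le_add (hm₀ : ∃ ν, α ν = m) (hm : ∀ ν, (m : EReal) ≤ α ν)
    {g g' : (Fin (n + 1) → E) → ℝ} {z z' : Fin n → E}
    (hg : Measurable g) (hg' : Measurable g') {C : ℝ} (hC : ∀ x, |g x| ≤ C)
    (hC' : ∀ x, |g' x| ≤ C) {d : ℝ} (h : ∀ t, g (Fin.snoc z t) ≤ g' (Fin.snoc z' t) + d) :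
    stepValue α g z ≤ stepValue α g' z' + d := by
  obtain ⟨ν₀, h₀⟩ := hm₀
  have : Nonempty {ν : ProbabilityMeasure E // α ν ≠ ⊤} := ⟨⟨ν₀, by simp [h₀]⟩⟩
  have hs : ∀ {u : (Fin (n + 1) → E) → ℝ} (z : Fin n → E), Measurable u →
      Measurable fun t => u (Fin.snoc z t) := fun z hu =>
    hu.comp ((measurable_snoc n).comp measurable_prodMk_left)
  refine ciSup_le fun ν => ?_
  have h1 := le_stepValue hm hC' z' ν.2
  have hi' := integrable_of_measurable_of_abs_le (μ := (ν.1 : Measure E)) (hs z' hg')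
    fun t => hC' _
  have h2 := integral_mono (μ := (ν.1 : Measure E))
    (integrable_of_measurable_of_abs_le (hs z hg) fun t => hC _)
    (hi'.add (integrable_const d)) h
  simp only [Pi.add_apply] at h2
  rw [integral_add hi' (integrable_const d), integral_const, probReal_univ, one_smul] at h2
  linarith

end StepValue

section Lipschitz

lemma dist_snoc_le {F : Type*} [PseudoMetricSpace F] {n : ℕ} (z z' : Fin n → F) (t : F) :
    dist (Fin.snoc z t : Fin (n + 1) → F) (Fin.snoc z' t) ≤ dist z z' := by
  refine (dist_pi_le_iff dist_nonneg).2 fun i => ?_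
  induction i using Fin.lastCases with
  | last => simp
  | cast i => simpa using dist_le_pi_dist z z' i

variable {E : Type*} [MeasurableSpace E] [MetricSpace E] [PolishSpace E] [BorelSpace E]
  {α : ProbabilityMeasure E → EReal} {m : ℝ}

lemma lipschitzWith_stepValue (hm₀ : ∃ ν, α ν = m) (hm : ∀ ν, (m : EReal) ≤ α ν) {n : ℕ}
    {g : (Fin (n + 1) → E) → ℝ} {K : ℝ≥0} (hg : LipschitzWith K g) {C : ℝ}
    (hC : ∀ x, |g x| ≤ C) : LipschitzWith K (stepValue α g) :=
  LipschitzWith.of_le_add_mul K fun z z' =>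
    stepValue_le_add hm₀ hm hg.continuous.measurable hg.continuous.measurable hC hC fun t =>
      (hg.le_add_mul _ _).trans
        (add_le_add le_rfl (mul_le_mul_of_nonneg_left (dist_snoc_le z z' t) K.2))

lemma hasChain_value (hm₀ : ∃ ν, α ν = m) (hm : ∀ ν, (m : EReal) ≤ α ν) :
    ∀ (n : ℕ) {g : (Fin n → E) → ℝ} {K : ℝ≥0} (_ : LipschitzWith K g) {C : ℝ}
      (_ : ∀ x, |g x| ≤ C), HasChain α (C + n * |m|) n g (value α n g)
  | 0, g, K, hg, C, hC => by
    refine ⟨fun _ _ => g Fin.elim0, fun _ => measurable_const, fun _ _ => ?_,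
      fun k hk => absurd hk (Nat.not_lt_zero k), fun x => ?_, fun _ => le_rfl⟩
    · simpa using hC Fin.elim0
    · rw [Subsingleton.elim x Fin.elim0]
  | n + 1, g, K, hg, C, hC => by
    obtain ⟨h, h1, h2, h3, h4, h5⟩ := hasChain_value hm₀ hm n
      (lipschitzWith_stepValue hm₀ hm hg hC) (abs_stepValue_le hm₀ hm hC)
    refine ⟨Function.update h (n + 1) g, fun k => ?_, fun k z => ?_, fun k hk z ν hν => ?_,
      fun x => ?_, fun z => ?_⟩
    · rcases eq_or_ne k (n + 1) with rfl | hk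
      · simpa using hg.continuous.measurable
      · simpa [Function.update_of_ne hk] using h1 k
    · rcases eq_or_ne k (n + 1) with rfl | hk
      · have h0 : 0 ≤ ((n + 1 : ℕ) : ℝ) * |m| := by positivity
        simpa using (hC z).trans (le_add_of_nonneg_right h0)
      · rw [Function.update_of_ne hk]
        have := h2 k z
        push_cast
        linarith
    · rw [Function.update_of_ne (by omega : k ≠ n + 1)]
      rcases Nat.lt_succ_iff_lt_or_eq.1 hk with hk' | rfl
      · rw [Function.update_of_ne (by omega : k + 1 ≠ n + 1)]
        exact h3 k hk' z ν hν
      · rw [Function.update_self]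
        exact (le_stepValue hm hC z hν).trans (h4 z)
    · simp
    · rw [Function.update_of_ne (by omega : (0 : ℕ) ≠ n + 1)]
      exact h5 z

end Lipschitz

section Selection

/-- The set of binary sequences whose reversed initial segment is the given list. -/
def binaryCylinder : List Bool → Set (ℕ → Bool)
  | [] => univ
  | c :: l => binaryCylinder l ∩ {b | b l.length = c}

lemma binaryCylinder_union (l : List Bool) :
    binaryCylinder (true :: l) ∪ binaryCylinder (false :: l) = binaryCylinder l := by
  ext b
  cases h : b l.length <;> simp [binaryCylinder, h]

/-- A sequence of extended-real functions that decreases and is upper semicontinuous in a binary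
sequence parameter admits a measurable choice of the parameter attaining the limiting supremum. -/
lemma exists_measurable_selection {X : Type*} [MeasurableSpace X]
    {G : ℕ → X → (ℕ → Bool) → EReal} (hanti : ∀ x b, Antitone fun k => G k x b)
    (husc : ∀ k x, UpperSemicontinuous (G k x))
    (hmeas : ∀ k (S : Set (ℕ → Bool)), Measurable fun x => ⨆ b ∈ S, G k x b) :
    ∃ s : X → ℕ → Bool, Measurable s ∧ ∀ x k, ⨅ j, ⨆ b, G j x b ≤ G k x (s x) := by
  let M : List Bool → X → EReal := fun l x => ⨅ k, ⨆ b ∈ binaryCylinder l, G k x b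
  have hM : ∀ l, Measurable (M l) := fun l => Measurable.iInf fun k => hmeas k _
  have hMnil : ∀ x, M [] x = ⨅ j, ⨆ b, G j x b := fun x => by simp [M, binaryCylinder]
  have hMsup : ∀ l x, M l x = M (true :: l) x ⊔ M (false :: l) x := fun l x => by
    have ha : ∀ l, Antitone fun k => ⨆ b ∈ binaryCylinder l, G k x b := fun l i j hij =>
      iSup₂_mono fun b _ => hanti x b hij
    rw [← iInf_sup_of_antitone (ha _) (ha _)]
    refine iInf_congr fun k => ?_
    rw [← binaryCylinder_union l, iSup_union]
  let p : ℕ → X → List Bool := fun j x =>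
    Nat.rec [] (fun _ l => decide (M [] x ≤ M (true :: l) x) :: l) j
  have hp : ∀ j x, p (j + 1) x = decide (M [] x ≤ M (true :: p j x) x) :: p j x :=
    fun _ _ => rfl
  have hlen : ∀ j x, (p j x).length = j := fun j x => by
    induction j with
    | zero => rfl
    | succ j ih => rw [hp, List.length_cons, ih]
  have hle : ∀ j x, M [] x ≤ M (p j x) x := fun j x => by
    induction j with
    | zero => exact le_rfl
    | succ j ih =>
      rw [hp]
      by_cases h : M [] x ≤ M (true :: p j x) x
      · simp [h]
      · simp only [h, decide_false]
        rw [hMsup (p j x), le_sup_iff] at ih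
        exact ih.resolve_left h
  have hpm : ∀ j l, MeasurableSet {x | p j x = l} := fun j => by
    induction j with
    | zero => exact fun l => MeasurableSet.const ([] = l)
    | succ j ih =>
      intro l
      cases l with
      | nil => simp [hp]
      | cons c l =>
        have : {x | p (j + 1) x = c :: l} =
            {x | p j x = l} ∩ {x | decide (M [] x ≤ M (true :: l) x) = c} := by
          ext x
          simp only [hp, List.cons.injEq, mem_ofPred_eq, mem_inter_iff]
          constructor
          · rintro ⟨h1, rfl⟩
            exact ⟨rfl, h1⟩
          · rintro ⟨rfl, h1⟩
            exact ⟨h1, rfl⟩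
        rw [this]
        refine (ih l).inter ?_
        have hms := measurableSet_le (hM []) (hM (true :: l))
        cases c
        · simpa [Set.compl_def] using hms.compl
        · simpa using hms
  let s : X → ℕ → Bool := fun x j => decide (M [] x ≤ M (true :: p j x) x)
  have hps : ∀ j x c, s x j = c ↔ ∃ l, p (j + 1) x = c :: l := fun j x c => by
    constructor
    · rintro rfl
      exact ⟨_, hp j x⟩
    · rintro ⟨l, hl⟩
      rw [hp] at hl
      exact (List.cons.inj hl).1
  have hcyl : ∀ j x, binaryCylinder (p j x) = PiNat.cylinder (s x) j := fun j x => by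
    induction j with
    | zero => simp [p, binaryCylinder]
    | succ j ih =>
      ext b
      have hb : b ∈ binaryCylinder (p (j + 1) x) ↔ b ∈ binaryCylinder (p j x) ∧ b j = s x j := by
        rw [hp]
        simp [binaryCylinder, hlen, s]
      rw [hb, ih, PiNat.mem_cylinder_iff, PiNat.mem_cylinder_iff, Nat.forall_lt_succ_right]
  refine ⟨s, measurable_pi_lambda _ fun j => measurable_to_countable' fun c => ?_,
    fun x k => ?_⟩
  · have : (fun x => s x j) ⁻¹' {c} = ⋃ l, {x | p (j + 1) x = c :: l} := by
      ext x
      simpa using hps j x c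
    rw [this]
    exact MeasurableSet.iUnion fun l => hpm (j + 1) (c :: l)
  · rw [← hMnil]
    by_contra! hlt
    obtain ⟨r, hr1, hr2⟩ := exists_between hlt
    have hnhds := husc k x (s x) r hr1
    obtain ⟨_, ⟨y, j, rfl⟩, hy, hsub⟩ :=
      (PiNat.isTopologicalBasis_cylinders (fun _ => Bool)).mem_nhds_iff.1 hnhds
    rw [← PiNat.mem_cylinder_iff_eq.1 hy, ← hcyl] at hsub
    have h1 : M (p j x) x ≤ r :=
      (iInf_le _ k).trans (iSup₂_le fun b hb => le_of_lt (hsub hb))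
    exact absurd ((hle j x).trans h1) (not_le.2 hr2)

variable {E : Type*} [MeasurableSpace E] [TopologicalSpace E] [PolishSpace E] [BorelSpace E]

lemma measurable_toMeasure_of_continuous {Y : Type*} [TopologicalSpace Y] [MeasurableSpace Y]
    [OpensMeasurableSpace Y] {π : Y → ProbabilityMeasure E} (hπ : Continuous π) :
    Measurable fun y => (π y : Measure E) := by
  refine Measurable.measure_of_isPiSystem_of_isProbabilityMeasure
    ((BorelSpace.measurable_eq (α := E)).trans borel_eq_generateFrom_isClosed)
    isPiSystem_isClosed fun F hF => ?_
  have hF : IsClosed F := hF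
  let := TopologicalSpace.upgradeIsCompletelyMetrizable E
  refine measurable_of_tendsto_metrizable
    (f := fun n y => ∫⁻ x, hF.apprSeq n x ∂(π y : Measure E)) (fun n => ?_)
    (tendsto_pi_nhds.2 fun y => HasOuterApproxClosed.tendsto_lintegral_apprSeq hF _)
  exact ((ProbabilityMeasure.continuous_lintegral_boundedContinuousFunction
    (hF.apprSeq n)).comp hπ).measurable

end Selection

section NearOptimalKernel

lemma continuous_snoc_right {F : Type*} [TopologicalSpace F] {n : ℕ} (z : Fin n → F) :
    Continuous fun t : F => (Fin.snoc z t : Fin (n + 1) → F) := by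
  refine continuous_pi fun i => ?_
  induction i using Fin.lastCases with
  | last => simpa using continuous_id'
  | cast i => simpa using continuous_const

lemma continuous_snoc_left {F : Type*} [TopologicalSpace F] {n : ℕ} (t : F) :
    Continuous fun z : Fin n → F => (Fin.snoc z t : Fin (n + 1) → F) := by
  refine continuous_pi fun i => ?_
  induction i using Fin.lastCases with
  | last => simpa using continuous_const
  | cast i => simpa using continuous_apply i

variable {E : Type*} [MeasurableSpace E] [TopologicalSpace E] [PolishSpace E] [BorelSpace E]
  {α : ProbabilityMeasure E → EReal} {m : ℝ} {n : ℕ}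

/-- A compact sublevel set of `α` carries, after parametrization by binary sequences, near-optimal
laws for every bounded integrand. -/
lemma exists_parametrization (hbot : ∀ ν, α ν ≠ ⊥)
    (hcompact : ∀ c : ℝ, IsCompact {ν : ProbabilityMeasure E | α ν ≤ (c : EReal)})
    (hm₀ : ∃ ν, α ν = m) {C : ℝ} (hC : 0 ≤ C) :
    ∃ π : (ℕ → Bool) → ProbabilityMeasure E, Continuous π ∧
      (∀ b, α (π b) ≤ ((m + 2 * C : ℝ) : EReal)) ∧
      ∀ g : E → ℝ, (∀ t, |g t| ≤ C) → ∀ ν, α ν ≠ ⊤ → ∃ b,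
        ∫ t, g t ∂(ν : Measure E) - (α ν).toReal ≤
          ∫ t, g t ∂(π b : Measure E) - (α (π b)).toReal := by
  set L := {ν : ProbabilityMeasure E | α ν ≤ ((m + 2 * C : ℝ) : EReal)}
  obtain ⟨ν₀, h₀⟩ := hm₀
  have hν₀ : ν₀ ∈ L := by
    simp only [L, mem_ofPred_eq, h₀, EReal.coe_le_coe_iff]
    linarith
  have : CompactSpace L := isCompact_iff_compactSpace.1 (hcompact _)
  have : Nonempty L := ⟨⟨ν₀, hν₀⟩⟩
  let := TopologicalSpace.upgradeIsCompletelyMetrizable E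
  let := TopologicalSpace.metrizableSpaceMetric L
  obtain ⟨π, hπ, hsurj⟩ := exists_nat_bool_continuous_surjective_of_compact L
  refine ⟨fun b => (π b).1, continuous_subtype_val.comp hπ, fun b => (π b).2,
    fun g hg ν hν => ?_⟩
  by_cases hL : ν ∈ L
  · obtain ⟨b, hb⟩ := hsurj ⟨ν, hL⟩
    exact ⟨b, by simp [hb]⟩
  · obtain ⟨b, hb⟩ := hsurj ⟨ν₀, hν₀⟩
    refine ⟨b, ?_⟩
    have h1 := abs_le.1 (abs_integral_le (ν : Measure E) hg)
    have h2 := abs_le.1 (abs_integral_le (ν₀ : Measure E) hg)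
    have h3 : m + 2 * C ≤ (α ν).toReal := by
      have h : ((m + 2 * C : ℝ) : EReal) ≤ α ν := (not_le.1 (show ¬ α ν ≤ _ from hL)).le
      rwa [← EReal.coe_toReal hν (hbot ν), EReal.coe_le_coe_iff] at h
    simp only [hb, h₀, EReal.toReal_coe]
    linarith

lemma exists_kernel_iInf_stepValue_le [Nonempty E] (hbot : ∀ ν, α ν ≠ ⊥)
    (hcompact : ∀ c : ℝ, IsCompact {ν : ProbabilityMeasure E | α ν ≤ (c : EReal)})
    (hm₀ : ∃ ν, α ν = m) (hm : ∀ ν, (m : EReal) ≤ α ν)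
    {v : ℕ → (Fin (n + 1) → E) → ℝ} (hv : ∀ k, Continuous (v k)) (hanti : Antitone v)
    {C : ℝ} (hC : ∀ k x, |v k x| ≤ C) :
    ∃ κ : Kernel (Fin n → E) E, ∃ _ : IsMarkovKernel κ, ∃ c : ℝ, ∀ z,
      extend α (κ z) ≤ c ∧ ⨅ k, stepValue α (v k) z ≤
        ∫ t, ⨅ k, v k (Fin.snoc z t) ∂(κ z) - (extend α (κ z)).toReal := by
  have hC0 : 0 ≤ C := (abs_nonneg _).trans (hC 0 fun _ => Classical.arbitrary E)
  obtain ⟨π, hπ, hπα, hπopt⟩ := exists_parametrization hbot hcompact hm₀ hC0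
  have hfin : ∀ b, α (π b) ≠ ⊤ := fun b => ((hπα b).trans_lt (EReal.coe_lt_top _)).ne
  let a : (ℕ → Bool) → ℝ := fun b => (α (π b)).toReal
  have ha : ∀ b, ((a b : ℝ) : EReal) = α (π b) := fun b => EReal.coe_toReal (hfin b) (hbot _)
  have halsc : LowerSemicontinuous a := by
    intro b r hr
    have h : (r : EReal) < α (π b) := by rwa [← ha, EReal.coe_lt_coe_iff]
    filter_upwards [(hπ.tendsto b).eventually
      (lowerSemicontinuous_of_isCompact_sublevel hbot hcompact (π b) r h)] with b' hb'
    rw [← ha] at hb'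
    exact EReal.coe_lt_coe_iff.1 hb'
  have hvs : ∀ k z, Continuous fun t => v k (Fin.snoc z t) := fun k z =>
    (hv k).comp (continuous_snoc_right z)
  have hvi : ∀ k z (μ : Measure E) [IsProbabilityMeasure μ],
      Integrable (fun t => v k (Fin.snoc z t)) μ := fun k z μ _ =>
    integrable_of_measurable_of_abs_le (hvs k z).measurable fun t => hC _ _
  let G : ℕ → (Fin n → E) → (ℕ → Bool) → EReal := fun k z b =>
    ((∫ t, v k (Fin.snoc z t) ∂(π b : Measure E) - a b : ℝ) : EReal)
  have hGanti : ∀ z b, Antitone fun k => G k z b := fun z b i j hij =>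
    EReal.coe_le_coe_iff.2 (sub_le_sub_right
      (integral_mono (hvi j z _) (hvi i z _) fun t => hanti hij _) _)
  have hGusc : ∀ k z, UpperSemicontinuous (G k z) := fun k z => by
    have hc : Continuous fun b => ∫ t, v k (Fin.snoc z t) ∂(π b : Measure E) :=
      (ProbabilityMeasure.continuous_integral_boundedContinuousFunction
        (BoundedContinuousFunction.ofNormedAddCommGroup _ (hvs k z) C fun t => hC _ _)).comp hπ
    have hs := hc.upperSemicontinuous.add halsc.neg
    simp only [Pi.neg_apply, ← sub_eq_add_neg] at hs
    exact continuous_coe_real_ereal.comp_upperSemicontinuous hs EReal.coe_strictMono.monotone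
  have hGmeas : ∀ k (S : Set (ℕ → Bool)), Measurable fun z => ⨆ b ∈ S, G k z b := fun k S => by
    refine (lowerSemicontinuous_biSup fun b _ => Continuous.lowerSemicontinuous ?_).measurable
    refine continuous_coe_real_ereal.comp (Continuous.sub ?_ continuous_const)
    exact continuous_of_dominated (bound := fun _ => C)
      (fun z => (hvs k z).measurable.aestronglyMeasurable)
      (fun z => Eventually.of_forall fun t => hC _ _) (integrable_const _)
      (Eventually.of_forall fun t => (hv k).comp (continuous_snoc_left t))
  obtain ⟨s, hs, hsG⟩ := exists_measurable_selection hGanti hGusc hGmeas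
  refine ⟨⟨fun z => (π (s z) : Measure E), (measurable_toMeasure_of_continuous hπ).comp hs⟩,
    ⟨fun z => inferInstanceAs (IsProbabilityMeasure (π (s z) : Measure E))⟩, m + 2 * C,
    fun z => ?_⟩
  change extend α (π (s z) : Measure E) ≤ _ ∧ _ ≤
    ∫ t, _ ∂(π (s z) : Measure E) - (extend α (π (s z) : Measure E)).toReal
  have hext : extend α (π (s z) : Measure E) = α (π (s z)) :=
    extend_of_isProbabilityMeasure α _
  rw [hext]
  refine ⟨hπα _, ?_⟩
  have hbb : ∀ z, BddBelow (range fun k => stepValue α (v k) z) := fun z =>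
    ⟨-(C + |m|), by rintro _ ⟨k, rfl⟩; exact (abs_le.1 (abs_stepValue_le hm₀ hm (hC k) z)).1⟩
  have hne : Nonempty {ν : ProbabilityMeasure E // α ν ≠ ⊤} :=
    ⟨⟨π (s z), hfin _⟩⟩
  have hle : ((⨅ k, stepValue α (v k) z : ℝ) : EReal) ≤ ⨅ j, ⨆ b, G j z b := by
    refine le_iInf fun k => (EReal.coe_le_coe_iff.2 (ciInf_le (hbb z) k)).trans ?_
    by_contra! hlt
    obtain ⟨r, hr1, hr2⟩ := EReal.lt_iff_exists_real_btwn.1 hlt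
    obtain ⟨ν, hν⟩ := exists_lt_of_lt_ciSup (EReal.coe_lt_coe_iff.1 hr2)
    obtain ⟨b, hb⟩ := hπopt (fun t => v k (Fin.snoc z t)) (fun t => hC _ _) ν.1 ν.2
    have h1 : (r : EReal) ≤ G k z b := EReal.coe_le_coe_iff.2 (hν.le.trans hb)
    exact absurd (h1.trans (le_iSup (G k z) b)) (not_le.2 hr1)
  have hlim : Tendsto (fun k => ∫ t, v k (Fin.snoc z t) ∂(π (s z) : Measure E)) atTop
      (𝓝 (∫ t, ⨅ k, v k (Fin.snoc z t) ∂(π (s z) : Measure E))) :=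
    tendsto_integral_of_dominated_convergence (fun _ => C)
      (fun k => (hvs k z).measurable.aestronglyMeasurable) (integrable_const _)
      (fun k => Eventually.of_forall fun t => hC _ _)
      (Eventually.of_forall fun t => tendsto_atTop_ciInf (fun i j hij => hanti hij _)
        ⟨-C, by rintro _ ⟨k, rfl⟩; exact (abs_le.1 (hC k _)).1⟩)
  exact ge_of_tendsto (hlim.sub_const _) (Eventually.of_forall fun k =>
    EReal.coe_le_coe_iff.1 (hle.trans (hsG z k)))

end NearOptimalKernel

section LowerBound

variable {E : Type*} [MeasurableSpace E]

lemma abs_iInf_le {v : ℕ → ℝ} {C : ℝ} (hC : ∀ k, |v k| ≤ C) : |⨅ k, v k| ≤ C :=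
  abs_le.2 ⟨le_ciInf fun k => (abs_le.1 (hC k)).1,
    (ciInf_le ⟨-C, by rintro _ ⟨k, rfl⟩; exact (abs_le.1 (hC k)).1⟩ 0).trans (abs_le.1 (hC 0)).2⟩

section Topological

variable [TopologicalSpace E] [PolishSpace E] [BorelSpace E] [Nonempty E]
  {α : ProbabilityMeasure E → EReal} {m : ℝ} {n : ℕ}

lemma rhon_mono {f g : (Fin n → E) → ℝ} (hf : Measurable f) (hg : Measurable g) {C : ℝ}
    (hCf : ∀ x, |f x| ≤ C) (hCg : ∀ x, |g x| ≤ C) (hfg : ∀ x, f x ≤ g x) :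
    rhon α n (fun x => (f x : EReal)) ≤ rhon α n (fun x => (g x : EReal)) := by
  refine iSup_mono fun ν => EReal.sub_le_sub ?_ le_rfl
  have hfi : Integrable f (ν : Measure (Fin n → E)) := integrable_of_measurable_of_abs_le hf hCf
  have hgi : Integrable g (ν : Measure (Fin n → E)) := integrable_of_measurable_of_abs_le hg hCg
  rw [erealIntegral_eq_integral hfi (Eventually.of_forall fun _ => rfl),
    erealIntegral_eq_integral hgi (Eventually.of_forall fun _ => rfl), EReal.coe_le_coe_iff]
  exact integral_mono hfi hgi hfg

/-- Concatenating a law with a kernel of bounded penalty compares `ρ` over consecutive horizons. -/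
lemma rhon_le_rhon_succ (hbot : ∀ ν, α ν ≠ ⊥)
    (hcompact : ∀ c : ℝ, IsCompact {ν : ProbabilityMeasure E | α ν ≤ (c : EReal)})
    (hm : ∀ ν, (m : EReal) ≤ α ν) {w : (Fin n → E) → ℝ} {u : (Fin (n + 1) → E) → ℝ}
    (hw : Measurable w) (hu : Measurable u) {C D : ℝ} (hD : ∀ z, |w z| ≤ D)
    (hC : ∀ x, |u x| ≤ C) {κ : Kernel (Fin n → E) E} [IsMarkovKernel κ] {c : ℝ}
    (hκ : ∀ z, extend α (κ z) ≤ c)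
    (hle : ∀ z, w z ≤ ∫ t, u (Fin.snoc z t) ∂(κ z) - (extend α (κ z)).toReal) :
    rhon α n (fun z => (w z : EReal)) ≤ rhon α (n + 1) (fun x => (u x : EReal)) := by
  refine iSup_le fun μ => ?_
  have hwi : Integrable w (μ : Measure (Fin n → E)) := integrable_of_measurable_of_abs_le hw hD
  rw [erealIntegral_eq_integral hwi (Eventually.of_forall fun _ => rfl)]
  by_cases hμ : alphan α n μ = ⊤
  · simp [hμ]
  have hμ' := alphan_ne_bot hbot hcompact hm n μ
  refine le_trans ?_ (le_iSup _ (snocLaw μ κ))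
  have hui : Integrable u (snocLaw μ κ : Measure (Fin (n + 1) → E)) :=
    integrable_of_measurable_of_abs_le hu hC
  have hfin : ∀ z, extend α (κ z) = ((extend α (κ z)).toReal : EReal) := fun z =>
    (EReal.coe_toReal ((hκ z).trans_lt (EReal.coe_lt_top _)).ne fun h => by
      simpa [h] using coe_le_extend hm (κ z)).symm
  have hab : ∀ z, |(extend α (κ z)).toReal| ≤ max |m| |c| := fun z => by
    have h1 := coe_le_extend hm (κ z)
    have h2 := hκ z
    rw [hfin z, EReal.coe_le_coe_iff] at h1 h2
    exact abs_le_max_abs_abs h1 h2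
  have hai : Integrable (fun z => (extend α (κ z)).toReal) (μ : Measure (Fin n → E)) :=
    integrable_of_measurable_of_abs_le (measurable_extend_kernel hbot hcompact κ).ereal_toReal hab
  have hae : (fun z => extend α (lastLaw (snocLaw μ κ) z)) =ᵐ[(μ : Measure (Fin n → E))]
      fun z => ((extend α (κ z)).toReal : EReal) := by
    filter_upwards [lastLaw_snocLaw μ κ] with z hz
    rw [hz]
    exact hfin z
  have hinner : Integrable (fun z => ∫ t, u (Fin.snoc z t) ∂(κ z)) (μ : Measure (Fin n → E)) :=
    Integrable.integral_compProd (κ := Kernel.const Unit (μ : Measure (Fin n → E)))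
      (η := Kernel.prodMkLeft Unit κ) (a := ()) (integrable_comp_snoc hui)
  rw [erealIntegral_eq_integral hui (Eventually.of_forall fun _ => rfl), integral_snocLaw hui,
    alphan_succ hbot hcompact, initLaw_snocLaw, erealIntegral_eq_integral hai hae,
    ← EReal.coe_toReal hμ hμ']
  have h := integral_mono hwi (hinner.sub hai) hle
  simp only [Pi.sub_apply] at h
  rw [integral_sub hinner hai] at h
  norm_cast
  linarith

end Topological

variable [MetricSpace E] [PolishSpace E] [BorelSpace E] [Nonempty E]
  {α : ProbabilityMeasure E → EReal} {m : ℝ}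

lemma le_rhon_iInf (hbot : ∀ ν, α ν ≠ ⊥)
    (hcompact : ∀ c : ℝ, IsCompact {ν : ProbabilityMeasure E | α ν ≤ (c : EReal)})
    (hm₀ : ∃ ν, α ν = m) (hm : ∀ ν, (m : EReal) ≤ α ν) {y : ℝ} :
    ∀ (n : ℕ) {v : ℕ → (Fin n → E) → ℝ} {K : ℕ → ℝ≥0} (_ : ∀ k, LipschitzWith (K k) (v k))
      (_ : Antitone v) {C : ℝ} (_ : ∀ k x, |v k x| ≤ C) (_ : ∀ k, y ≤ value α n (v k)),
      (y : EReal) ≤ rhon α n (fun x => ((⨅ k, v k x : ℝ) : EReal))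
  | 0, v, K, hv, hanti, C, hC, hy => by
    obtain ⟨ν⟩ : Nonempty (ProbabilityMeasure (Fin 0 → E)) :=
      ⟨⟨Measure.dirac Fin.elim0, inferInstance⟩⟩
    have hconst : (fun x : Fin 0 → E => ⨅ k, v k x) = fun _ => ⨅ k, v k Fin.elim0 :=
      funext fun x => by rw [Subsingleton.elim x Fin.elim0]
    refine le_trans ?_ (le_iSup _ ν)
    rw [alphan_zero, sub_zero, erealIntegral_eq_integral (f := fun x => ⨅ k, v k x)
      (integrable_of_measurable_of_abs_le (Measurable.iInf fun k => (hv k).continuous.measurable)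
        fun x => abs_iInf_le fun k => hC k x) (Eventually.of_forall fun _ => rfl),
      EReal.coe_le_coe_iff, hconst, integral_const, probReal_univ, one_smul]
    exact le_ciInf fun k => hy k
  | n + 1, v, K, hv, hanti, C, hC, hy => by
    have hv' : ∀ k, Continuous (v k) := fun k => (hv k).continuous
    obtain ⟨κ, _, c, hκ⟩ :=
      exists_kernel_iInf_stepValue_le hbot hcompact hm₀ hm hv' hanti hC
    have hlip := fun k => lipschitzWith_stepValue hm₀ hm (hv k) (hC k)
    have habs := fun k => abs_stepValue_le hm₀ hm (hC k)
    refine (le_rhon_iInf hbot hcompact hm₀ hm n hlip (fun i j hij z => ?_) habs hy).trans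
      (rhon_le_rhon_succ hbot hcompact hm (Measurable.iInf fun k => (hlip k).continuous.measurable)
        (Measurable.iInf fun k => (hv' k).measurable) (fun z => abs_iInf_le fun k => habs k z)
        (fun x => abs_iInf_le fun k => hC k x) (fun z => (hκ z).1) fun z => (hκ z).2)
    simpa using stepValue_le_add (d := 0) (z := z) (z' := z) hm₀ hm (hv' j).measurable
      (hv' i).measurable (hC j) (hC i) fun t => by simpa using hanti hij _

end LowerBound

section Capacity

lemma exists_continuous_parametrization {X : Type*} [TopologicalSpace X] [PolishSpace X]
    [MeasurableSpace X] [BorelSpace X] [Nonempty X] {f : X → ℝ} (hf : Measurable f) :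
    ∃ p : (ℕ → ℕ) → X, Continuous p ∧ Function.Surjective p ∧ Continuous (f ∘ p) := by
  obtain ⟨t, ht, hfc, htp⟩ := hf.exists_continuous
  obtain ⟨p, hp, hps⟩ := @PolishSpace.exists_nat_nat_continuous_surjective X t htp _
  exact ⟨p, continuous_le_rng ht hp, hps, hfc.comp hp⟩

section Majorant

variable {X : Type*} [PseudoMetricSpace X] {f : X → ℝ} {C : ℝ} {p : (ℕ → ℕ) → X}
  {S : Set (ℕ → ℕ)} {k : ℕ}

/-- The least `k`-Lipschitz function with values at least `-C` that dominates `f` on `p '' S`. -/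
def lipschitzMajorant (f : X → ℝ) (C : ℝ) (p : (ℕ → ℕ) → X) (S : Set (ℕ → ℕ)) (k : ℕ)
    (x : X) : ℝ :=
  ⨆ σ, if σ ∈ S then max (-C) (f (p σ) - k * dist x (p σ)) else -C

lemma lipschitzMajorant_term_le (hC : ∀ x, |f x| ≤ C) (x : X) (σ : ℕ → ℕ) :
    (if σ ∈ S then max (-C) (f (p σ) - k * dist x (p σ)) else -C) ≤ C := by
  have h := abs_le.1 (hC (p σ))
  have h0 : 0 ≤ (k : ℝ) * dist x (p σ) := by positivity
  split_ifs
  · exact max_le (by linarith) (by linarith)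
  · linarith

lemma bddAbove_lipschitzMajorant (hC : ∀ x, |f x| ≤ C) (x : X) :
    BddAbove (range fun σ => if σ ∈ S then max (-C) (f (p σ) - k * dist x (p σ)) else -C) :=
  ⟨C, by rintro _ ⟨σ, rfl⟩; exact lipschitzMajorant_term_le hC x σ⟩

lemma neg_le_lipschitzMajorant (hC : ∀ x, |f x| ≤ C) (x : X) :
    -C ≤ lipschitzMajorant f C p S k x := by
  refine le_trans ?_ (le_ciSup (bddAbove_lipschitzMajorant hC x) fun _ => 0)
  split_ifs
  · exact le_max_left _ _
  · exact le_rfl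

lemma abs_lipschitzMajorant_le (hC : ∀ x, |f x| ≤ C) (x : X) :
    |lipschitzMajorant f C p S k x| ≤ C :=
  abs_le.2 ⟨neg_le_lipschitzMajorant hC x, ciSup_le fun σ => lipschitzMajorant_term_le hC x σ⟩

lemma le_lipschitzMajorant (hC : ∀ x, |f x| ≤ C) (x : X) {σ : ℕ → ℕ} (hσ : σ ∈ S) :
    f (p σ) - k * dist x (p σ) ≤ lipschitzMajorant f C p S k x := by
  refine le_trans ?_ (le_ciSup (bddAbove_lipschitzMajorant hC x) σ)
  simp [hσ]

lemma lipschitzWith_lipschitzMajorant (hC : ∀ x, |f x| ≤ C) :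
    LipschitzWith k (lipschitzMajorant f C p S k) := by
  refine LipschitzWith.of_le_add_mul _ fun x x' => ciSup_le fun σ => ?_
  have h0 : 0 ≤ ((k : ℝ≥0) : ℝ) * dist x x' := by positivity
  have h1 := neg_le_lipschitzMajorant (p := p) (S := S) (k := k) hC x'
  split_ifs with hσ
  · refine max_le (by linarith) ?_
    have h2 := le_lipschitzMajorant (p := p) (k := k) hC x' hσ
    have h3 := mul_le_mul_of_nonneg_left (dist_triangle_left x' (p σ) x) (Nat.cast_nonneg (α := ℝ) k)
    rw [NNReal.coe_natCast]
    rw [mul_add] at h3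
    linarith
  · linarith

lemma lipschitzMajorant_anti (hC : ∀ x, |f x| ≤ C) {S' : Set (ℕ → ℕ)} {k' : ℕ} (hS : S' ⊆ S)
    (hk : k ≤ k') (x : X) :
    lipschitzMajorant f C p S' k' x ≤ lipschitzMajorant f C p S k x := by
  refine ciSup_le fun σ => ?_
  split_ifs with hσ
  · refine max_le (neg_le_lipschitzMajorant hC x)
      (le_trans ?_ (le_lipschitzMajorant hC x (hS hσ)))
    gcongr
  · exact neg_le_lipschitzMajorant hC x

/-- Along sets of sequences that shrink to a compact set, the Lipschitz majorants with growing
constants decrease below `f`. -/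
lemma iInf_lipschitzMajorant_le [T0Space X] (hC : ∀ x, |f x| ≤ C) (hp : Continuous p)
    (hfp : Continuous (f ∘ p)) {S : ℕ → Set (ℕ → ℕ)} {b : ℕ → ℕ}
    (hS : ∀ k, ∀ σ ∈ S k, ∀ i < k, σ i ≤ b i) (x : X) :
    ⨅ k, lipschitzMajorant f C p (S k) k x ≤ f x := by
  by_contra! hlt
  obtain ⟨r, hr1, hr2⟩ := exists_between hlt
  have hbb : BddBelow (range fun k => lipschitzMajorant f C p (S k) k x) :=
    ⟨-C, by rintro _ ⟨k, rfl⟩; exact neg_le_lipschitzMajorant hC x⟩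
  have hex : ∀ k, ∃ σ ∈ S k, r < f (p σ) - k * dist x (p σ) := fun k => by
    obtain ⟨σ, hσ⟩ := exists_lt_of_lt_ciSup (hr2.trans_le (ciInf_le hbb k))
    have hrC : -C < r := (abs_le.1 (hC x)).1.trans_lt hr1
    split_ifs at hσ with hmem
    · exact ⟨σ, hmem, (lt_max_iff.1 hσ).resolve_left hrC.not_gt⟩
    · exact absurd hσ hrC.not_gt
  choose σ hσS hσ using hex
  let c : ℕ → ℕ := fun i => b i + ∑ k ∈ Finset.range (i + 1), σ k i
  have hcomp : IsCompact (univ.pi fun i => Iic (c i)) :=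
    isCompact_univ_pi fun i => (finite_Iic (c i)).isCompact
  have hmem : ∀ k, σ k ∈ univ.pi fun i => Iic (c i) := fun k i _ => by
    rcases lt_or_ge i k with h | h
    · exact (hS k _ (hσS k) i h).trans (Nat.le_add_right _ _)
    · exact (Finset.single_le_sum (f := fun k => σ k i) (fun _ _ => Nat.zero_le _)
        (Finset.mem_range.2 (Nat.lt_succ_of_le h))).trans (Nat.le_add_left _ _)
  obtain ⟨τ, -, φ, hφ, hτ⟩ := hcomp.tendsto_subseq hmem
  have hd : ∀ j, (φ j : ℝ) * dist x (p (σ (φ j))) ≤ C - r := fun j => by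
    linarith [hσ (φ j), (abs_le.1 (hC (p (σ (φ j))))).2]
  have hdist : Tendsto (fun j => dist x (p (σ (φ j)))) atTop (𝓝 0) := by
    have hlim : Tendsto (fun j => (C - r) / (φ j : ℝ)) atTop (𝓝 0) :=
      tendsto_const_nhds.div_atTop (tendsto_natCast_atTop_atTop.comp hφ.tendsto_atTop)
    refine tendsto_of_tendsto_of_tendsto_of_le_of_le' tendsto_const_nhds hlim
      (Eventually.of_forall fun _ => dist_nonneg) ?_
    filter_upwards [eventually_gt_atTop 0] with j hj
    have hpos : (0 : ℝ) < φ j := Nat.cast_pos.2 (hj.trans_le (hφ.id_le j))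
    rw [le_div_iff₀ hpos, mul_comm]
    exact hd j
  have hpx : p τ = x := by
    have h1 := (tendsto_const_nhds (x := x)).dist ((hp.tendsto τ).comp hτ)
    exact ((Metric.inseparable_iff.2 (tendsto_nhds_unique h1 hdist)).eq).symm
  have hge : r ≤ f (p τ) := ge_of_tendsto ((hfp.tendsto τ).comp hτ)
    (Eventually.of_forall fun j => by
      have h0 : (0 : ℝ) ≤ (φ j : ℝ) * dist x (p (σ (φ j))) := by positivity
      have := hσ (φ j)
      simp only [Function.comp_apply]
      linarith)
  rw [hpx] at hge
  linarith

end Majorant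

/-- If `f` has no chain below `y`, then neither do its restrictions to a suitable sequence of
images shrinking to the image of a compact set. -/
lemma exists_seq_not_hasChain {E : Type*} [MeasurableSpace E] {α : ProbabilityMeasure E → EReal}
    {B : ℝ} {n : ℕ} {f : (Fin n → E) → ℝ} {y C : ℝ} (hC : ∀ x, |f x| ≤ C)
    {p : (ℕ → ℕ) → (Fin n → E)} (hp : Function.Surjective p) (h : ¬ HasChain α B n f y) :
    ∃ (S : ℕ → Set (ℕ → ℕ)) (b : ℕ → ℕ), Antitone S ∧
      (∀ k, ∀ σ ∈ S k, ∀ i < k, σ i ≤ b i) ∧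
      ∀ k, ¬ HasChain α B n (fun x => if x ∈ p '' S k then f x else -C) y := by
  let Q : Set (ℕ → ℕ) → Prop := fun S =>
    ¬ HasChain α B n (fun x => if x ∈ p '' S then f x else -C) y
  have h0 : Q univ := by
    simpa only [Q, image_univ, hp.range_eq, mem_univ, if_true] using h
  have hstep : ∀ (S : {S // Q S}) (j : ℕ), ∃ b, Q (S.1 ∩ {σ | σ j ≤ b}) := by
    rintro ⟨S, hS⟩ j
    by_contra! hcon
    simp only [Q, not_not] at hcon
    refine hS (HasChain.of_eventually_le hcon (fun x => ?_) tendsto_const_nhds)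
    have hlow : ∀ b, -C ≤ if x ∈ p '' (S ∩ {σ | σ j ≤ b}) then f x else -C := fun b => by
      split_ifs
      · exact (abs_le.1 (hC x)).1
      · exact le_rfl
    by_cases hx : x ∈ p '' S
    · obtain ⟨σ, hσ, rfl⟩ := hx
      filter_upwards [eventually_ge_atTop (σ j)] with b hb
      rw [if_pos (mem_image_of_mem p hσ),
        if_pos (mem_image_of_mem p (show σ ∈ S ∩ {σ | σ j ≤ b} from ⟨hσ, hb⟩))]
    · rw [if_neg hx]
      exact Eventually.of_forall hlow
  choose bb hbb using hstep
  let T : ℕ → {S // Q S} := fun k =>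
    Nat.rec ⟨univ, h0⟩ (fun k S => ⟨S.1 ∩ {σ | σ k ≤ bb S k}, hbb S k⟩) k
  have hT : ∀ k, (T (k + 1)).1 = (T k).1 ∩ {σ | σ k ≤ bb (T k) k} := fun k => rfl
  refine ⟨fun k => (T k).1, fun k => bb (T k) k,
    antitone_nat_of_succ_le fun k => (hT k).trans_subset inter_subset_left, fun k => ?_,
    fun k => (T k).2⟩
  induction k with
  | zero => exact fun σ _ i hi => absurd hi (Nat.not_lt_zero i)
  | succ k ih =>
    intro σ hσ i hi
    have hσ : σ ∈ (T k).1 ∩ {σ | σ k ≤ bb (T k) k} := hσ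
    rcases Nat.lt_succ_iff_lt_or_eq.1 hi with hi | rfl
    · exact ih σ hσ.1 i hi
    · exact hσ.2

lemma le_rhon_of_not_hasChain_of_metricSpace {E : Type*} [MeasurableSpace E] [MetricSpace E]
    [PolishSpace E] [BorelSpace E] [Nonempty E] {α : ProbabilityMeasure E → EReal}
    (hbot : ∀ ν, α ν ≠ ⊥)
    (hcompact : ∀ c : ℝ, IsCompact {ν : ProbabilityMeasure E | α ν ≤ (c : EReal)})
    {m : ℝ} (hm₀ : ∃ ν, α ν = m) (hm : ∀ ν, (m : EReal) ≤ α ν) {n : ℕ} {f : (Fin n → E) → ℝ}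
    (hf : Measurable f) {C : ℝ} (hC : ∀ x, |f x| ≤ C) {y : ℝ}
    (h : ¬ HasChain α (C + n * |m|) n f y) :
    (y : EReal) ≤ rhon α n (fun x => (f x : EReal)) := by
  obtain ⟨p, hp, hps, hfp⟩ := exists_continuous_parametrization hf
  obtain ⟨S, b, hS, hSb, hSQ⟩ := exists_seq_not_hasChain hC hps h
  have hlip : ∀ k : ℕ, LipschitzWith (k : ℝ≥0) (lipschitzMajorant f C p (S k) k) := fun k =>
    lipschitzWith_lipschitzMajorant hC
  have habs : ∀ k x, |lipschitzMajorant f C p (S k) k x| ≤ C := fun k x =>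
    abs_lipschitzMajorant_le hC x
  refine (le_rhon_iInf hbot hcompact hm₀ hm n hlip
    (fun i j hij x => lipschitzMajorant_anti hC (hS hij) hij x) habs fun k => ?_).trans
    (rhon_mono (Measurable.iInf fun k => (hlip k).continuous.measurable) hf
      (fun x => abs_iInf_le fun k => habs k x) hC fun x => iInf_lipschitzMajorant_le hC hp hfp hSb x)
  by_contra! hlt
  refine hSQ k ((hasChain_value hm₀ hm n (hlip k) (habs k)).mono (fun x => ?_) hlt.le)
  split_ifs with hx
  · obtain ⟨σ, hσ, rfl⟩ := hx
    simpa using le_lipschitzMajorant (p := p) (k := k) hC (p σ) hσ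
  · exact neg_le_lipschitzMajorant hC x

lemma le_rhon_of_not_hasChain {E : Type*} [MeasurableSpace E] [t : TopologicalSpace E]
    [PolishSpace E] [BorelSpace E] [Nonempty E] {α : ProbabilityMeasure E → EReal}
    (hbot : ∀ ν, α ν ≠ ⊥)
    (hcompact : ∀ c : ℝ, IsCompact {ν : ProbabilityMeasure E | α ν ≤ (c : EReal)})
    {m : ℝ} (hm₀ : ∃ ν, α ν = m) (hm : ∀ ν, (m : EReal) ≤ α ν) {n : ℕ} {f : (Fin n → E) → ℝ}
    (hf : Measurable f) {C : ℝ} (hC : ∀ x, |f x| ≤ C) {y : ℝ}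
    (h : ¬ HasChain α (C + n * |m|) n f y) :
    (y : EReal) ≤ rhon α n (fun x => (f x : EReal)) := by
  obtain ⟨d, hd⟩ : ∃ d : MetricSpace E, d.toUniformSpace.toTopologicalSpace = t :=
    ⟨TopologicalSpace.metrizableSpaceMetric E, rfl⟩
  subst hd
  exact le_rhon_of_not_hasChain_of_metricSpace hbot hcompact hm₀ hm hf hC h

lemma hasChain_const {E : Type*} [MeasurableSpace E] {α : ProbabilityMeasure E → EReal} {m : ℝ}
    (hm : ∀ ν, (m : EReal) ≤ α ν) (n : ℕ) {C : ℝ} (hC0 : 0 ≤ C) {f : (Fin n → E) → ℝ}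
    (hC : ∀ x, |f x| ≤ C) : HasChain α (C + n * |m|) n f (C + n * |m|) := by
  refine ⟨fun k _ => C + (n - k : ℕ) * |m|, fun k => measurable_const, fun k z => ?_,
    fun k hk z ν hν => ?_, fun x => ?_, fun z => by simp⟩
  · have h0 : abs (C + (n - k : ℕ) * |m|) ≤ C + n * |m| := by
      rw [abs_of_nonneg (by positivity)]
      gcongr
      exact Nat.sub_le n k
    exact h0
  · have h1 : -|m| ≤ (α ν).toReal := (neg_abs_le m).trans (by
      simpa using EReal.toReal_le_toReal (hm ν) (EReal.coe_ne_bot m) hν)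
    have h2 : ((n - k : ℕ) : ℝ) = (n - (k + 1) : ℕ) + 1 := by
      exact_mod_cast (by omega : n - k = n - (k + 1) + 1)
    rw [integral_const, probReal_univ, one_smul]
    change _ ≤ C + (n - k : ℕ) * |m|
    rw [h2]
    linarith
  · simpa using (le_abs_self _).trans (hC x)

end Capacity

/-- **Theorem 1.7** (superhedging representation of `ρ_n`): `ρ_n(f)` is the least `y` for which a
superhedging strategy exists, and the infimum is attained. -/
theorem superhedging
    {E : Type*} [MeasurableSpace E] [TopologicalSpace E] [PolishSpace E] [BorelSpace E]
    [Nonempty E]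
    (α : ProbabilityMeasure E → EReal)
    (hproper : ∃ ν, α ν ≠ ⊤) (hbot : ∀ ν, α ν ≠ ⊥)
    (hconvex : ∀ (μ₁ μ₂ : ProbabilityMeasure E) (t : ℝ≥0), t ≤ 1 →
      extend α ((t : ℝ≥0∞) • (μ₁ : Measure E) + ((1 - t : ℝ≥0) : ℝ≥0∞) • (μ₂ : Measure E))
        ≤ ((t : ℝ) : EReal) * α μ₁ + (((1 - t : ℝ≥0) : ℝ) : EReal) * α μ₂)
    (hcompact : ∀ c : ℝ, IsCompact {ν : ProbabilityMeasure E | α ν ≤ (c : EReal)})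
    (n : ℕ) (f : (Fin n → E) → ℝ) (hfmeas : Measurable f) (hfbdd : ∃ C : ℝ, ∀ x, |f x| ≤ C) :
    ∃ y ∈ hedgeSet α n f,
      (y : EReal) = rhon α n (fun x => ((f x : ℝ) : EReal)) ∧
      ∀ y' ∈ hedgeSet α n f, y ≤ y' := by
  obtain ⟨C, hC⟩ := hfbdd
  obtain ⟨m, hm₀, hm⟩ := exists_isMinimizer hproper hbot hcompact
  obtain ⟨x₀⟩ : Nonempty (Fin n → E) := inferInstance
  have hC0 : 0 ≤ C := (abs_nonneg _).trans (hC x₀)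
  have hle : ∀ y ∈ hedgeSet α n f, rhon α n (fun x => ((f x : ℝ) : EReal)) ≤ y := fun y hy =>
    rhon_le_of_mem_hedgeSet hbot hcompact hm hfmeas hC hy
  have hlt : ∀ y : ℝ, rhon α n (fun x => ((f x : ℝ) : EReal)) < y →
      HasChain α (C + n * |m|) n f y := fun y hy => by
    by_contra h
    exact hy.not_ge (le_rhon_of_not_hasChain hbot hcompact hm₀ hm hfmeas hC h)
  have htop : rhon α n (fun x => ((f x : ℝ) : EReal)) ≠ ⊤ :=
    ((hle _ ((hasChain_const hm n hC0 hC).mem_hedgeSet hbot)).trans_lt (EReal.coe_lt_top _)).ne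
  have hne_bot : rhon α n (fun x => ((f x : ℝ) : EReal)) ≠ ⊥ := fun h => by
    obtain ⟨g, -, hg, -, -, hy⟩ := hlt (-(C + n * |m|) - 1) (h ▸ EReal.bot_lt_coe _)
    linarith [hy Fin.elim0, (abs_le.1 (hg 0 Fin.elim0)).1]
  have hr := EReal.coe_toReal htop hne_bot
  generalize (rhon α n (fun x => ((f x : ℝ) : EReal))).toReal = r at hr
  have hchain : HasChain α (C + n * |m|) n f r := by
    refine HasChain.of_eventually_le (gs := fun _ => f) (ys := fun i => r + 1 / ((i : ℝ) + 1))
      (fun i => hlt _ ?_) (fun x => Eventually.of_forall fun _ => le_rfl) ?_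
    · rw [← hr, EReal.coe_lt_coe_iff]
      exact lt_add_of_pos_right r Nat.one_div_pos_of_nat
    · simpa using tendsto_one_div_add_atTop_nhds_zero_nat.const_add r
  refine ⟨r, hchain.mem_hedgeSet hbot, hr, fun y' hy' => ?_⟩
  rw [← EReal.coe_le_coe_iff, hr]
  exact hle y' hy'

end SanovDual
end
end
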